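/- Let G be a finite simple graph on the vertex set {1,…,ℓ}. The projective dimension of the S-module D(A(G)) is at most 1 if and only if G is weakly chordal. -/

import Mathlib

open MvPolynomial CategoryTheory

/-- The polynomial ring `S = ℚ[x_1, …, x_ℓ]` (variables indexed by `Fin ℓ`). -/
abbrev Spoly (ℓ : ℕ) : Type := MvPolynomial (Fin ℓ) ℚ

/-- The module `D(A(G))` of logarithmic derivations of the graphic arrangement of a
graph `G` on the vertex set `{1, …, ℓ}`: all `θ ∈ Der_ℚ(S)` such that `(x_i - x_j)`
divides `θ(x_i) - θ(x_j)` for every edge `{i, j}` of `G`. -/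
noncomputable def logDer (ℓ : ℕ) (G : SimpleGraph (Fin ℓ)) :
    Submodule (Spoly ℓ) (Derivation ℚ (Spoly ℓ) (Spoly ℓ)) where
  carrier := {θ | ∀ i j : Fin ℓ, G.Adj i j → (X i - X j) ∣ θ (X i) - θ (X j)}
  add_mem' := by
    intro a b ha hb i j h
    have : (a + b) (X i) - (a + b) (X j)
        = (a (X i) - a (X j)) + (b (X i) - b (X j)) := by
      simp only [Derivation.add_apply]; ring
    rw [this]
    exact dvd_add (ha i j h) (hb i j h)
  zero_mem' := by intro i j h; simp
  smul_mem' := by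
    intro c θ hθ i j h
    have : (c • θ) (X i) - (c • θ) (X j) = c * (θ (X i) - θ (X j)) := by
      simp only [Derivation.smul_apply, smul_eq_mul]; ring
    rw [this]
    exact (hθ i j h).mul_left c

/-- `pdLE M n` : `M` admits a projective resolution vanishing in homological
degrees above `n`, i.e. the projective dimension of `M` is at most `n`. -/
def pdLE {R : Type} [CommRing R] (M : ModuleCat R) (n : ℕ) : Prop :=
  ∃ P : ProjectiveResolution M, ∀ i : ℕ, n < i → Limits.IsZero (P.complex.X i)

/-- The projective dimension of a module, as an element of `ℕ∞`
(infimum of the lengths of projective resolutions; `⊤` if there is none of finite length). -/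
noncomputable def pd {R : Type} [CommRing R] (M : ModuleCat R) : ℕ∞ :=
  sInf {n : ℕ∞ | ∃ k : ℕ, (k : ℕ∞) = n ∧ pdLE M k}

/-- `G` contains an induced cycle of length `n`, i.e. an induced subgraph
isomorphic to the cycle graph on `n` vertices. -/
def HasInducedCycleLen {V : Type} (G : SimpleGraph V) (n : ℕ) : Prop :=
  ∃ s : Set V, Nonempty (G.induce s ≃g SimpleGraph.cycleGraph n)

/-- A graph is chordal if it has no induced cycle of length at least 4. -/
def Chordal {V : Type} (G : SimpleGraph V) : Prop :=
  ∀ n : ℕ, 4 ≤ n → ¬ HasInducedCycleLen G n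

/-- A graph is weakly chordal if neither it nor its complement contains an
induced cycle of length at least 5. -/
def WeaklyChordal {V : Type} (G : SimpleGraph V) : Prop :=
  (∀ n : ℕ, 5 ≤ n → ¬ HasInducedCycleLen G n) ∧
  (∀ n : ℕ, 5 ≤ n → ¬ HasInducedCycleLen Gᶜ n)

/-- `M` has a projective presentation `0 → P₁ → P₀ → M → 0`. -/
def HasShortResolution {R : Type} [CommRing R] (M : Type) [AddCommGroup M] [Module R M] : Prop :=
  ∃ (P : Type) (_ : AddCommGroup P) (_ : Module R P) (p : P →ₗ[R] M),
    Module.Projective R P ∧ Function.Surjective p ∧ Module.Projective R (LinearMap.ker p)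

section ShortResolution

variable {R : Type} [CommRing R] {M : Type} [AddCommGroup M] [Module R M]

/-- The chain complex `0 → A → B` of modules, with `B` in degree `0`. -/
noncomputable def twoTermObj (A B : ModuleCat.{0} R) : ℕ → ModuleCat.{0} R
  | 0 => B
  | 1 => A
  | _ + 2 => ModuleCat.of R PUnit

/-- The differentials of the chain complex `0 → A → B`. -/
noncomputable def twoTermD {A B : ModuleCat.{0} R} (f : A ⟶ B) :
    ∀ n : ℕ, twoTermObj A B (n + 1) ⟶ twoTermObj A B n
  | 0 => f
  | _ + 1 => 0

/-- The chain complex `0 → A → B`, with `B` in degree `0`. -/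
noncomputable def twoTerm {A B : ModuleCat.{0} R} (f : A ⟶ B) : ChainComplex (ModuleCat.{0} R) ℕ :=
  ChainComplex.of (twoTermObj A B) (twoTermD f) (fun n => by
    cases n <;> exact Limits.zero_comp)

lemma isZero_twoTerm_X {A B : ModuleCat.{0} R} (f : A ⟶ B) (n : ℕ) :
    Limits.IsZero ((twoTerm f).X (n + 2)) :=
  ModuleCat.isZero_of_iff_subsingleton.2 (inferInstanceAs (Subsingleton PUnit))

lemma twoTerm_d_one_zero {A B : ModuleCat.{0} R} (f : A ⟶ B) : (twoTerm f).d 1 0 = f :=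
  ChainComplex.of_d (twoTermObj A B) (twoTermD f) 0

lemma pdLE_one_of_shortExact {A B C : ModuleCat.{0} R} (f : A ⟶ B) (g : B ⟶ C)
    (w : f ≫ g = 0) (hex : (ShortComplex.mk f g w).Exact) [Mono f] [Epi g]
    [Projective A] [Projective B] : pdLE C 1 := by
  have hz : (twoTerm f).d 1 0 ≫ g = 0 := by rw [twoTerm_d_one_zero]; exact w
  refine ⟨{ complex := twoTerm f
            projective := ?_
            π := (ChainComplex.toSingle₀Equiv _ _).symm ⟨g, hz⟩
            quasiIso := ⟨?_⟩ }, ?_⟩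
  · rintro (_ | _ | n)
    · assumption
    · assumption
    · exact (isZero_twoTerm_X f n).projective
  · rintro (_ | n)
    · rw [ChainComplex.quasiIsoAt₀_iff, ShortComplex.quasiIso_iff_of_zeros']
      · refine (ShortComplex.exact_and_epi_g_iff_of_iso ?_).2
          ⟨hex, by dsimp; infer_instance⟩
        refine ShortComplex.isoMk (Iso.refl _) (Iso.refl _) (Iso.refl _) ?_ ?_
        · change 𝟙 _ ≫ f = (twoTerm f).d 1 0 ≫ 𝟙 _
          rw [twoTerm_d_one_zero]
          exact (Category.id_comp f).trans (Category.comp_id f).symm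
        · exact (Category.id_comp g).trans (Category.comp_id g).symm
      all_goals rfl
    · rw [quasiIsoAt_iff_exactAt']
      · rw [HomologicalComplex.exactAt_iff' _ (n + 2) (n + 1) n (by simp) (by simp)]
        cases n with
        | zero =>
          refine (ShortComplex.exact_iff_mono _ ((isZero_twoTerm_X f 0).eq_of_src _ _)).2 ?_
          change Mono ((twoTerm f).d 1 0)
          rw [twoTerm_d_one_zero]; assumption
        | succ n => exact ShortComplex.exact_of_isZero_X₂ _ (isZero_twoTerm_X f n)
      · apply ChainComplex.exactAt_succ_single_obj
  · intro i hi
    obtain ⟨j, rfl⟩ := Nat.exists_eq_add_of_le hi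
    rw [show 1 + 1 + j = j + 2 by omega]
    exact isZero_twoTerm_X f j

lemma HasShortResolution.pdLE_one (h : HasShortResolution (R := R) M) :
    pdLE (ModuleCat.of R M) 1 := by
  obtain ⟨P, _, _, p, hP, hsurj, hK⟩ := h
  let f : ModuleCat.of R (LinearMap.ker p) ⟶ ModuleCat.of R P :=
    ModuleCat.ofHom (LinearMap.ker p).subtype
  let g : ModuleCat.of R P ⟶ ModuleCat.of R M := ModuleCat.ofHom p
  have : Mono f := (ModuleCat.mono_iff_injective _).2 Subtype.val_injective
  have : Epi g := (ModuleCat.epi_iff_surjective _).2 hsurj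
  have : Projective (ModuleCat.of R P) := (IsProjective.iff_projective P).1 hP
  have : Projective (ModuleCat.of R (LinearMap.ker p)) :=
    (IsProjective.iff_projective _).1 hK
  refine pdLE_one_of_shortExact f g (by ext x; exact x.2) ?_
  rw [ShortComplex.moduleCat_exact_iff]
  intro x hx
  exact ⟨⟨x, hx⟩, rfl⟩

lemma pdLE.hasShortResolution {n : ℕ} (hn : n ≤ 1) (h : pdLE (ModuleCat.of R M) n) :
    HasShortResolution (R := R) M := by
  obtain ⟨P, hP⟩ := h
  have hz : Limits.IsZero (P.complex.X 2) := hP 2 (by omega)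
  have hex1 := P.exact_succ 0
  have hex0 := P.exact₀
  have hmono : Mono (P.complex.d 1 0) :=
    (ShortComplex.exact_iff_mono _ (hz.eq_of_src _ _)).1 hex1
  have hepi : Epi (P.π.f 0) := inferInstance
  refine ⟨P.complex.X 0, inferInstance, inferInstance, (P.π.f 0).hom,
    (IsProjective.iff_projective _).2 (P.projective 0),
    (ModuleCat.epi_iff_surjective _).1 hepi, ?_⟩
  have hpr1 : Module.Projective R (P.complex.X 1) :=
    (IsProjective.iff_projective _).2 (P.projective 1)
  have hmem : ∀ x, (P.complex.d 1 0).hom x ∈ LinearMap.ker (P.π.f 0).hom := fun x => by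
    have := congrArg (fun φ => φ.hom x) P.complex_d_comp_π_f_zero
    exact this
  refine Module.Projective.of_equiv (LinearEquiv.ofBijective
    ((P.complex.d 1 0).hom.codRestrict (LinearMap.ker (P.π.f 0).hom) hmem) ⟨?_, ?_⟩)
  · intro x y hxy
    exact (ModuleCat.mono_iff_injective _).1 hmono (congrArg Subtype.val hxy)
  · rintro ⟨y, hy⟩
    rw [ShortComplex.moduleCat_exact_iff] at hex0
    obtain ⟨x, hx⟩ := hex0 y hy
    exact ⟨x, Subtype.ext hx⟩

lemma pd_le_one_iff : pd (ModuleCat.of R M) ≤ 1 ↔ HasShortResolution (R := R) M := by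
  constructor
  · intro h
    have : sInf {n : ℕ∞ | ∃ k : ℕ, (k : ℕ∞) = n ∧ pdLE (ModuleCat.of R M) k} < 2 :=
      lt_of_le_of_lt h (by norm_num)
    obtain ⟨n, ⟨k, rfl, hk⟩, hlt⟩ := sInf_lt_iff.1 this
    have : k < 2 := by exact_mod_cast hlt
    exact hk.hasShortResolution (by omega)
  · intro h
    exact sInf_le ⟨1, by simp, h.pdLE_one⟩

end ShortResolution

section Graph

variable {V : Type}

lemma Fin.val_sub_eq_one_iff {n : ℕ} (hn : 2 ≤ n) (u v : Fin n) :
    (u - v).val = 1 ↔ v.val + 1 = u.val ∨ (u.val = 0 ∧ v.val + 1 = n) := by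
  have hu := u.2
  have hv := v.2
  rcases le_or_gt v u with h | h
  · rw [Fin.coe_sub_iff_le.2 h]
    have : v.val ≤ u.val := h
    omega
  · rw [Fin.coe_sub_iff_lt.2 h]
    have : u.val < v.val := h
    omega

lemma cycleGraph_adj_val {n : ℕ} (hn : 2 ≤ n) (u v : Fin n) :
    (SimpleGraph.cycleGraph n).Adj u v ↔ (u.val + 1 = v.val ∨ v.val + 1 = u.val) ∨
      (u.val = 0 ∧ v.val + 1 = n) ∨ (v.val = 0 ∧ u.val + 1 = n) := by
  rw [SimpleGraph.cycleGraph_adj', Fin.val_sub_eq_one_iff hn, Fin.val_sub_eq_one_iff hn]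
  tauto

lemma hasInducedCycleLen_iff {G : SimpleGraph V} {n : ℕ} :
    HasInducedCycleLen G n ↔ Nonempty (SimpleGraph.cycleGraph n ↪g G) := by
  constructor
  · rintro ⟨s, ⟨e⟩⟩
    exact ⟨(SimpleGraph.Embedding.induce s).comp e.symm.toEmbedding⟩
  · rintro ⟨f⟩
    exact ⟨Set.range f, ⟨f.isoInduceRange.symm⟩⟩

/-- The vertices `p 0, …, p k` are distinct and induce a path in `G`, in this order. -/
def IsIndPath (G : SimpleGraph V) (p : ℕ → V) (k : ℕ) : Prop :=
  (∀ i ≤ k, ∀ j ≤ k, p i = p j → i = j) ∧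
    ∀ i ≤ k, ∀ j ≤ k, (G.Adj (p i) (p j) ↔ i + 1 = j ∨ j + 1 = i)

lemma IsIndPath.shift {G : SimpleGraph V} {p : ℕ → V} {k : ℕ} (h : IsIndPath G p k) (i m : ℕ)
    (hm : i + m ≤ k) : IsIndPath G (fun j => p (i + j)) m := by
  refine ⟨fun a ha b hb hab => ?_, fun a ha b hb => ?_⟩
  · have := h.1 (i + a) (by omega) (i + b) (by omega) hab
    omega
  · have := h.2 (i + a) (by omega) (i + b) (by omega)
    simp only [this]
    omega

lemma IsIndPath.take {G : SimpleGraph V} {p : ℕ → V} {k : ℕ} (h : IsIndPath G p k) {m : ℕ}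
    (hm : m ≤ k) : IsIndPath G p m :=
  ⟨fun a ha b hb => h.1 a (by omega) b (by omega), fun a ha b hb => h.2 a (by omega) b (by omega)⟩

lemma IsIndPath.extend {G : SimpleGraph V} {p : ℕ → V} {k : ℕ} (h : IsIndPath G p k) {z : V}
    (hz : ∀ i ≤ k, z ≠ p i) (hadj : ∀ i ≤ k, (G.Adj z (p i) ↔ i = k)) :
    IsIndPath G (fun i => if i ≤ k then p i else z) (k + 1) := by
  refine ⟨fun i hi j hj hij => ?_, fun i hi j hj => ?_⟩
  · by_cases h1 : i ≤ k <;> by_cases h2 : j ≤ k <;> simp only [h1, h2, if_true, if_false] at hij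
    · exact h.1 i h1 j h2 hij
    · exact absurd hij.symm (hz i h1)
    · exact absurd hij (hz j h2)
    · omega
  · by_cases h1 : i ≤ k <;> by_cases h2 : j ≤ k <;> simp only [h1, h2, if_true, if_false]
    · exact h.2 i h1 j h2
    · rw [G.adj_comm, hadj i h1]; omega
    · rw [hadj j h2]; omega
    · simp only [SimpleGraph.irrefl, false_iff]; omega

/-- An induced path together with a vertex adjacent to exactly its two ends is an induced cycle. -/
lemma IsIndPath.hasInducedCycleLen {G : SimpleGraph V} {p : ℕ → V} {k : ℕ} (h : IsIndPath G p k)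
    {z : V} (hz : ∀ i ≤ k, z ≠ p i)
    (hadj : ∀ i ≤ k, (G.Adj z (p i) ↔ i = 0 ∨ i = k)) : HasInducedCycleLen G (k + 2) := by
  rw [hasInducedCycleLen_iff]
  refine ⟨⟨⟨fun i => if i.val ≤ k then p i.val else z, ?_⟩, ?_⟩⟩
  · intro i j hij
    have hi := i.2
    have hj := j.2
    apply Fin.ext
    by_cases h1 : i.val ≤ k <;> by_cases h2 : j.val ≤ k <;>
      simp only [h1, h2, if_true, if_false] at hij
    · exact h.1 i h1 j h2 hij
    · exact absurd hij.symm (hz i h1)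
    · exact absurd hij (hz j h2)
    · omega
  · intro i j
    have hi := i.2
    have hj := j.2
    rw [cycleGraph_adj_val (by omega)]
    change G.Adj (if i.val ≤ k then p i.val else z) (if j.val ≤ k then p j.val else z) ↔ _
    by_cases h1 : i.val ≤ k <;> by_cases h2 : j.val ≤ k <;> simp only [h1, h2, if_true, if_false]
    · rw [h.2 i h1 j h2]; omega
    · rw [G.adj_comm, hadj i h1]; omega
    · rw [hadj j h2]; omega
    · simp only [SimpleGraph.irrefl, false_iff]; omega

lemma exists_chain_of_reflTransGen {r : V → V → Prop} {a b : V} (h : Relation.ReflTransGen r a b) :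
    ∃ (k : ℕ) (p : ℕ → V), p 0 = a ∧ p k = b ∧ ∀ i < k, r (p i) (p (i + 1)) := by
  induction h with
  | refl => exact ⟨0, fun _ => a, rfl, rfl, by simp⟩
  | @tail b c _ hbc ih =>
    obtain ⟨k, p, h0, hk, hp⟩ := ih
    refine ⟨k + 1, fun i => if i ≤ k then p i else c, by simp [h0], by simp, fun i hi => ?_⟩
    rcases Nat.lt_or_ge i k with h | h
    · simpa [show i ≤ k by omega, show i + 1 ≤ k by omega] using hp i h
    · obtain rfl : i = k := by omega
      simpa [hk] using hbc

/-- A shortest connection from `a` to `b` through `T` is an induced path. -/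
lemma exists_isIndPath_of_reflTransGen {H : SimpleGraph V} {T : Set V} {a b : V}
    (h : Relation.ReflTransGen (fun u v => H.Adj u v ∧ v ∈ T) a b) :
    ∃ (k : ℕ) (p : ℕ → V), p 0 = a ∧ p k = b ∧ IsIndPath H p k ∧
      ∀ i, 1 ≤ i → i ≤ k → p i ∈ T := by
  classical
  have hex := exists_chain_of_reflTransGen h
  obtain ⟨p, h0, hk, hp⟩ := Nat.find_spec hex
  have hmin := fun m => Nat.find_min (H := hex) (m := m)
  set k := Nat.find hex with hkdef
  clear_value k
  -- Shortcut from position `i` to position `j > i + e` (replacing `i + e` by `j`).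
  have cut : ∀ i j e, i + e < j → j ≤ k →
      (∀ m, m < k - (j - (i + e)) →
        (fun u v => H.Adj u v ∧ v ∈ T) (if m < i + e then p m else p (m + (j - (i + e))))
          (if m + 1 < i + e then p (m + 1) else p (m + 1 + (j - (i + e))))) →
      (if 0 < i + e then p 0 else p (0 + (j - (i + e)))) = a → False := by
    intro i j e hij hj hstep hstart
    refine hmin (k - (j - (i + e))) (by omega)
      ⟨fun m => if m < i + e then p m else p (m + (j - (i + e))), hstart, ?_, hstep⟩
    have h1 : ¬ (k - (j - (i + e)) < i + e) := by omega
    simp only [h1, if_false]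
    rw [show k - (j - (i + e)) + (j - (i + e)) = k by omega, hk]
  have inj : ∀ i j, i < j → j ≤ k → p i ≠ p j := by
    intro i j hij hj heq
    refine cut i j 0 (by omega) hj (fun m hm => ?_) ?_
    · rcases lt_trichotomy (m + 1) i with h | h | h
      · rw [if_pos (by omega), if_pos (by omega)]; exact hp m (by omega)
      · rw [if_pos (by omega), if_neg (by omega), show m + 1 + (j - (i + 0)) = j by omega, ← heq,
          ← h]
        exact hp m (by omega)
      · rw [if_neg (by omega), if_neg (by omega),
          show m + 1 + (j - (i + 0)) = m + (j - (i + 0)) + 1 by omega]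
        exact hp _ (by omega)
    · split_ifs with h
      · exact h0
      · rw [show 0 + (j - (i + 0)) = j by omega, ← heq, show i = 0 by omega, h0]
  have nadj : ∀ i j, i + 1 < j → j ≤ k → ¬ H.Adj (p i) (p j) := by
    intro i j hij hj hadj
    refine cut i j 1 (by omega) hj (fun m hm => ?_) ?_
    · rcases lt_trichotomy m i with h | h | h
      · rw [if_pos (by omega), if_pos (by omega)]; exact hp m (by omega)
      · rw [if_pos (by omega), if_neg (by omega), show m + 1 + (j - (i + 1)) = j by omega, h]
        refine ⟨hadj, ?_⟩
        have := (hp (j - 1) (by omega)).2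
        rwa [show j - 1 + 1 = j by omega] at this
      · rw [if_neg (by omega), if_neg (by omega),
          show m + 1 + (j - (i + 1)) = m + (j - (i + 1)) + 1 by omega]
        exact hp _ (by omega)
    · rw [if_pos (by omega), h0]
  refine ⟨k, p, h0, hk, ⟨fun i hi j hj hij => ?_, fun i hi j hj => ⟨fun hadj => ?_, ?_⟩⟩, ?_⟩
  · rcases lt_trichotomy i j with h | h | h
    · exact absurd hij (inj i j h hj)
    · exact h
    · exact absurd hij.symm (inj j i h hi)
  · by_contra hcon
    rcases lt_trichotomy i j with h | h | h
    · exact nadj i j (by omega) hj hadj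
    · subst h; exact H.irrefl hadj
    · exact nadj j i (by omega) hi hadj.symm
  · rintro (rfl | rfl)
    · exact (hp i (by omega)).1
    · exact (hp j (by omega)).1.symm
  · intro i h1 hi
    have := (hp (i - 1) (by omega)).2
    rwa [show i - 1 + 1 = i by omega] at this

/-- The set `T` induces a connected (or empty) subgraph of `H`. -/
def ConnectedWithin (H : SimpleGraph V) (T : Set V) : Prop :=
  ∀ a ∈ T, ∀ b ∈ T, Relation.ReflTransGen (fun u v => H.Adj u v ∧ v ∈ T) a b

lemma reflTransGen_mono_set {H : SimpleGraph V} {T T' : Set V} (hT : T ⊆ T') {a b : V}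
    (h : Relation.ReflTransGen (fun u v => H.Adj u v ∧ v ∈ T) a b) :
    Relation.ReflTransGen (fun u v => H.Adj u v ∧ v ∈ T') a b :=
  Relation.ReflTransGen.mono (fun _ _ h => ⟨h.1, hT h.2⟩) a b h

lemma ConnectedWithin.insert_of_adj {H : SimpleGraph V} {T : Set V} (h : ConnectedWithin H T) {x t : V}
    (ht : t ∈ T) (hxt : H.Adj x t) : ConnectedWithin H (insert x T) := by
  have hsub : T ⊆ insert x T := Set.subset_insert x T
  rintro a (rfl | ha) b (rfl | hb)
  · exact .refl
  · exact .head ⟨hxt, hsub ht⟩ (reflTransGen_mono_set hsub (h t ht b hb))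
  · exact .tail (reflTransGen_mono_set hsub (h a ha t ht)) ⟨hxt.symm, Set.mem_insert _ _⟩
  · exact reflTransGen_mono_set hsub (h a ha b hb)

/-- In a weakly chordal graph, if both ends of an induced path with at least three edges are
complete to a set `T` which is connected in the complement, then one of the first two inner vertices
is complete to `T`. -/
lemma WeaklyChordal.complete_inner {G : SimpleGraph V} (hG : WeaklyChordal G) {T : Set V}
    (hT : ConnectedWithin Gᶜ T) {p : ℕ → V} {k : ℕ} (hp : IsIndPath G p k) (hk : 3 ≤ k)
    (h0 : ∀ t ∈ T, G.Adj t (p 0)) (hend : ∀ t ∈ T, G.Adj t (p k)) :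
    (∀ t ∈ T, G.Adj t (p 1)) ∨ (∀ t ∈ T, G.Adj t (p 2)) := by
  classical
  by_contra! hcon
  obtain ⟨⟨s, hs, hs1⟩, ⟨t, ht, ht2⟩⟩ := hcon
  have adj : ∀ i j, i ≤ k → j ≤ k → (G.Adj (p i) (p j) ↔ i + 1 = j ∨ j + 1 = i) :=
    fun i j hi hj => hp.2 i hi j hj
  have ne : ∀ i j, i ≤ k → j ≤ k → i ≠ j → p i ≠ p j :=
    fun i j hi hj h h' => h (hp.1 i hi j hj h')
  have h1T : p 1 ∉ T := fun h => by
    have := (adj 1 k (by omega) le_rfl).1 (hend _ h); omega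
  have h2T : p 2 ∉ T := fun h => by
    have := (adj 2 0 (by omega) (by omega)).1 (h0 _ h); omega
  have hc1 : Gᶜ.Adj (p 1) s :=
    (G.compl_adj _ _).2 ⟨fun h => h1T (h ▸ hs), fun h => hs1 h.symm⟩
  have hc2 : Gᶜ.Adj t (p 2) := (G.compl_adj _ _).2 ⟨fun h => h2T (h ▸ ht), ht2⟩
  have hsub : T ⊆ insert (p 2) T := Set.subset_insert _ _
  have hreach : Relation.ReflTransGen (fun u v => Gᶜ.Adj u v ∧ v ∈ insert (p 2) T) (p 1) (p 2) :=
    .tail (.head ⟨hc1, hsub hs⟩ (reflTransGen_mono_set hsub (hT s hs t ht)))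
      ⟨hc2, Set.mem_insert _ _⟩
  obtain ⟨m, q, hq0, hqm, hq, hqT⟩ := exists_isIndPath_of_reflTransGen hreach
  have hm0 : m ≠ 0 := by
    rintro rfl
    exact ne 1 2 (by omega) (by omega) (by omega) (hq0.symm.trans hqm)
  have hm1 : m ≠ 1 := by
    rintro rfl
    have h := (hq.2 0 (by omega) 1 le_rfl).2 (Or.inl rfl)
    rw [hq0, hqm, G.compl_adj] at h
    exact h.2 ((adj 1 2 (by omega) (by omega)).2 (by omega))
  have hqT' : ∀ i, i ≠ 0 → i ≠ m → i ≤ m → q i ∈ T := by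
    intro i hi him hile
    rcases hqT i (by omega) hile with h | h
    · exact absurd (hq.1 i hile m le_rfl (h.trans hqm.symm)) him
    · exact h
  have notT : ∀ i, i = 0 ∨ i = k → ∀ z ∈ T, p i ≠ z := by
    rintro i (rfl | rfl) z hz rfl
    · exact G.irrefl (h0 _ hz)
    · exact G.irrefl (hend _ hz)
  rcases Nat.lt_or_ge 3 k with hk4 | hk3
  · rcases Nat.lt_or_ge 2 m with hm3 | hm2
    · refine hG.2 (m + 2) (by omega) (hq.hasInducedCycleLen (z := p k) (fun i hi => ?_)
        fun i hi => ?_)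
      · by_cases h0' : i = 0
        · rw [h0', hq0]; exact ne _ _ le_rfl (by omega) (by omega)
        by_cases hm' : i = m
        · rw [hm', hqm]; exact ne _ _ le_rfl (by omega) (by omega)
        exact notT k (Or.inr rfl) _ (hqT' i h0' hm' hi)
      · by_cases h0' : i = 0
        · simp only [h0', hq0, true_or, iff_true, G.compl_adj]
          exact ⟨ne _ _ le_rfl (by omega) (by omega), fun h => by
            have := (adj k 1 le_rfl (by omega)).1 h; omega⟩
        by_cases hm' : i = m
        · simp only [hm', hqm, or_true, iff_true, G.compl_adj]
          exact ⟨ne _ _ le_rfl (by omega) (by omega), fun h => by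
            have := (adj k 2 le_rfl (by omega)).1 h; omega⟩
        simp only [h0', hm', or_self, iff_false, G.compl_adj, not_and, not_not]
        exact fun _ => (hend _ (hqT' i h0' hm' hi)).symm
    · obtain rfl : m = 2 := by omega
      set z := q 1 with hz
      have hzT : z ∈ T := hqT' 1 (by omega) (by omega) (by omega)
      have hz1 : ¬ G.Adj z (p 1) := by
        have h := (hq.2 1 (by omega) 0 (by omega)).2 (by omega)
        rw [hq0, G.compl_adj] at h
        exact h.2
      have hz2 : ¬ G.Adj z (p 2) := by
        have h := (hq.2 1 (by omega) 2 (by omega)).2 (by omega)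
        rw [hqm, G.compl_adj] at h
        exact h.2
      have hex : ∃ j, 1 ≤ j ∧ j ≤ k ∧ G.Adj z (p j) := ⟨k, by omega, le_rfl, hend z hzT⟩
      obtain ⟨hj1, hjk, hjadj⟩ := Nat.find_spec hex
      have hmin := fun m => Nat.find_min (H := hex) (m := m)
      set j := Nat.find hex
      clear_value j
      have hj3 : 3 ≤ j := by
        by_contra hlt
        have : j = 1 ∨ j = 2 := by omega
        rcases this with rfl | rfl
        · exact hz1 hjadj
        · exact hz2 hjadj
      refine hG.1 (j + 2) (by omega) ((hp.take hjk).hasInducedCycleLen (z := z) (fun i hi => ?_)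
        fun i hi => ?_)
      · intro h
        have hadj0 := (adj i 0 (by omega) (by omega)).1 (h ▸ h0 z hzT)
        obtain rfl : i = 1 := by omega
        exact h1T (h ▸ hzT)
      · constructor
        · intro h
          by_contra! hne
          exact hmin i (by omega) ⟨by omega, by omega, h⟩
        · rintro (rfl | rfl)
          · exact h0 z hzT
          · exact hjadj
  · obtain rfl : k = 3 := by omega
    have hq' : IsIndPath Gᶜ (fun i => if i ≤ m then q i else p 0) (m + 1) := by
      refine hq.extend (fun i hi => ?_) fun i hi => ?_
      · by_cases h0' : i = 0
        · rw [h0', hq0]; exact ne _ _ (by omega) (by omega) (by omega)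
        by_cases hm' : i = m
        · rw [hm', hqm]; exact ne _ _ (by omega) (by omega) (by omega)
        exact notT 0 (Or.inl rfl) _ (hqT' i h0' hm' hi)
      · by_cases hm' : i = m
        · simp only [hm', hqm, iff_true, G.compl_adj]
          exact ⟨ne _ _ (by omega) (by omega) (by omega), fun h => by
            have := (adj 0 2 (by omega) (by omega)).1 h; omega⟩
        simp only [hm', iff_false, G.compl_adj, not_and, not_not]
        intro _
        by_cases h0' : i = 0
        · rw [h0', hq0]; exact (adj 0 1 (by omega) (by omega)).2 (by omega)
        exact (h0 _ (hqT' i h0' hm' hi)).symm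
    refine hG.2 (m + 1 + 2) (by omega) (hq'.hasInducedCycleLen (z := p 3) (fun i hi => ?_)
        fun i hi => ?_)
    · by_cases hle : i ≤ m
      · simp only [hle, if_true]
        by_cases h0' : i = 0
        · rw [h0', hq0]; exact ne _ _ (by omega) (by omega) (by omega)
        by_cases hm' : i = m
        · rw [hm', hqm]; exact ne _ _ (by omega) (by omega) (by omega)
        exact notT 3 (Or.inr rfl) _ (hqT' i h0' hm' hle)
      · simp only [hle, if_false]
        exact ne _ _ (by omega) (by omega) (by omega)
    · by_cases hle : i ≤ m
      · simp only [hle, if_true]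
        by_cases h0' : i = 0
        · simp only [h0', hq0, true_or, iff_true, G.compl_adj]
          exact ⟨ne _ _ (by omega) (by omega) (by omega), fun h => by
            have := (adj 3 1 (by omega) (by omega)).1 h; omega⟩
        have hne : i ≠ m + 1 := by omega
        simp only [h0', hne, or_self, iff_false, G.compl_adj, not_and, not_not]
        intro _
        by_cases hm' : i = m
        · rw [hm', hqm]; exact (adj 3 2 (by omega) (by omega)).2 (by omega)
        exact (hend _ (hqT' i h0' hm' hle)).symm
      · obtain rfl : i = m + 1 := by omega
        simp only [hle, if_false, or_true, iff_true, G.compl_adj]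
        exact ⟨ne _ _ (by omega) (by omega) (by omega), fun h => by
            have := (adj 3 0 (by omega) (by omega)).1 h; omega⟩

/-- The vertices `a` and `b` of `U` are distinct, not adjacent, and every induced path between them
with all vertices in `U` has at most two edges. -/
def IsTwoPair (G : SimpleGraph V) (U : Set V) (a b : V) : Prop :=
  a ≠ b ∧ ¬ G.Adj a b ∧ ∀ (p : ℕ → V) (k : ℕ), 3 ≤ k → IsIndPath G p k → p 0 = a → p k = b →
    ∃ i ≤ k, p i ∉ U

/-- Every induced subgraph of a weakly chordal graph is complete or contains a two-pair. -/
lemma WeaklyChordal.exists_isTwoPair {G : SimpleGraph V} (hG : WeaklyChordal G) (U : Finset V)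
    (hU : ∃ a ∈ U, ∃ b ∈ U, a ≠ b ∧ ¬ G.Adj a b) : ∃ a ∈ U, ∃ b ∈ U, IsTwoPair G U a b := by
  classical
  induction U using Finset.strongInduction with
  | H U ih =>
  let C : Finset V → Finset V := fun T => U.filter fun v => ∀ t ∈ T, G.Adj t v
  have hC : ∀ T v, v ∈ C T ↔ v ∈ U ∧ ∀ t ∈ T, G.Adj t v := fun T v => by simp [C]
  let good : Finset V → Prop := fun T => T.Nonempty ∧ ConnectedWithin Gᶜ (T : Set V) ∧
    ∃ a ∈ C T, ∃ b ∈ C T, a ≠ b ∧ ¬ G.Adj a b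
  by_cases hgood : ∃ T ∈ U.powerset, good T
  · obtain ⟨T, hT, hmax⟩ := Finset.exists_max_image (U.powerset.filter good) Finset.card (by
      obtain ⟨T, hT, hg⟩ := hgood
      exact ⟨T, by simp only [Finset.mem_filter]; exact ⟨hT, hg⟩⟩)
    simp only [Finset.mem_filter, Finset.mem_powerset] at hT hmax
    obtain ⟨hTU, ⟨t0, ht0⟩, hconn, hCT⟩ := hT
    have hsub : C T ⊂ U := by
      refine Finset.ssubset_iff_subset_ne.2 ⟨Finset.filter_subset _ _, fun h => ?_⟩
      have : t0 ∈ C T := h ▸ hTU ht0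
      exact G.irrefl (((hC _ _).1 this).2 t0 ht0)
    obtain ⟨a, ha, b, hb, hne, hnadj, hpair⟩ := ih (C T) hsub hCT
    refine ⟨a, hsub.1 ha, b, hsub.1 hb, hne, hnadj, fun p k hk hp h0 hkb => ?_⟩
    by_contra! hpU
    have step : ∀ i, i + 2 ≤ k → p i ∈ C T → p (i + 1) ∈ C T ∨ p (i + 2) ∈ C T := by
      intro i hi hpi
      rcases Nat.lt_or_ge (i + 2) k with h | h
      · have := hG.complete_inner hconn (hp.shift i (k - i) (by omega)) (by omega)
          (fun t ht => ((hC _ _).1 hpi).2 t ht)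
          (fun t ht => by
            simp only [show i + (k - i) = k by omega, hkb]
            exact ((hC _ _).1 hb).2 t ht)
        rcases this with h | h
        · exact .inl ((hC _ _).2 ⟨hpU _ (by omega), fun t ht => h t ht⟩)
        · exact .inr ((hC _ _).2 ⟨hpU _ (by omega), fun t ht => h t ht⟩)
      · obtain h : i + 2 = k := by omega
        exact .inr (by rw [h, hkb]; exact hb)
    have next : ∀ i, i + 2 ≤ k → p i ∈ C T → p (i + 1) ∈ C T := by
      intro i hi hpi
      by_contra hcon
      have h2 : p (i + 2) ∈ C T := (step i hi hpi).resolve_left hcon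
      have hnT : p (i + 1) ∉ T := by
        intro h
        have h1 := (hp.2 (i + 1) (by omega) 0 (by omega)).1
          (by rw [h0]; exact ((hC _ _).1 ha).2 _ h)
        have h2 := (hp.2 (i + 1) (by omega) k le_rfl).1
          (by rw [hkb]; exact ((hC _ _).1 hb).2 _ h)
        omega
      have : ∃ t ∈ T, ¬ G.Adj t (p (i + 1)) := by
        by_contra! h
        exact hcon ((hC _ _).2 ⟨hpU _ (by omega), h⟩)
      obtain ⟨t, ht, htadj⟩ := this
      have hins : good (insert (p (i + 1)) T) := by
        refine ⟨Finset.insert_nonempty _ _, ?_, p i, ?_, p (i + 2), ?_, fun h => ?_, fun h => ?_⟩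
        · rw [Finset.coe_insert]
          exact hconn.insert_of_adj (t := t) ht
            ((G.compl_adj _ _).2 ⟨fun h => hnT (h ▸ ht), fun h => htadj h.symm⟩)
        · refine (hC _ _).2 ⟨hpU _ (by omega), fun s hs => ?_⟩
          rcases Finset.mem_insert.1 hs with rfl | hs
          · exact (hp.2 _ (by omega) _ (by omega)).2 (by omega)
          · exact ((hC _ _).1 hpi).2 s hs
        · refine (hC _ _).2 ⟨hpU _ (by omega), fun s hs => ?_⟩
          rcases Finset.mem_insert.1 hs with rfl | hs
          · exact (hp.2 _ (by omega) _ (by omega)).2 (by omega)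
          · exact ((hC _ _).1 h2).2 s hs
        · have := hp.1 _ (by omega) _ (by omega) h
          omega
        · have := (hp.2 _ (by omega) _ (by omega)).1 h
          omega
      have hle := hmax (insert (p (i + 1)) T)
        ⟨Finset.insert_subset (hpU _ (by omega)) hTU, hins⟩
      rw [Finset.card_insert_of_notMem hnT] at hle
      omega
    have all : ∀ i < k, p i ∈ C T := by
      intro i
      induction i with
      | zero => intro _; rw [h0]; exact ha
      | succ i ihi => intro h; exact next i (by omega) (ihi (by omega))
    obtain ⟨i, hi, hpi⟩ := hpair p k hk hp h0 hkb
    rcases Nat.lt_or_ge i k with h | h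
    · exact hpi (all i h)
    · obtain rfl : i = k := by omega
      exact hpi (by rw [hkb]; exact hb)
  · push Not at hgood
    obtain ⟨a, ha, b, hb, hne, hnadj⟩ := hU
    refine ⟨a, ha, b, hb, hne, hnadj, fun p k hk hp h0 hkb => ?_⟩
    by_contra! hpU
    refine hgood {p 1} (by simpa using hpU 1 (by omega)) ⟨Finset.singleton_nonempty _, ?_,
      p 0, ?_, p 2, ?_, fun h => ?_, fun h => ?_⟩
    · rintro x hx y hy
      simp only [Finset.coe_singleton, Set.mem_singleton_iff] at hx hy
      subst hx; subst hy
      exact .refl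
    · simp only [hC, Finset.mem_singleton, forall_eq]
      exact ⟨hpU _ (by omega), (hp.2 _ (by omega) _ (by omega)).2 (by omega)⟩
    · simp only [hC, Finset.mem_singleton, forall_eq]
      exact ⟨hpU _ (by omega), (hp.2 _ (by omega) _ (by omega)).2 (by omega)⟩
    · have := hp.1 _ (by omega) _ (by omega) h
      omega
    · have := (hp.2 _ (by omega) _ (by omega)).1 h
      omega

/-- Any two adjacent vertices of an induced cycle are the ends of a rotated, possibly reflected,
copy of it. -/
lemma exists_cycle_embedding_ends {G : SimpleGraph V} {n : ℕ}
    (f : SimpleGraph.cycleGraph (n + 2) ↪g G) {u v : Fin (n + 2)}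
    (h : (SimpleGraph.cycleGraph (n + 2)).Adj u v) :
    ∃ f' : SimpleGraph.cycleGraph (n + 2) ↪g G, f' 0 = f u ∧ f' (Fin.last (n + 1)) = f v := by
  have hlast : (Fin.last (n + 1)) = -1 := by
    rw [eq_neg_iff_add_eq_zero, Fin.last_add_one]
  have hone : ∀ w : Fin (n + 2), w.val = 1 → w = 1 := fun w hw => Fin.ext (by simpa using hw)
  rw [SimpleGraph.cycleGraph_adj'] at h
  rcases h with h | h
  · refine ⟨⟨⟨fun w => f (u + w), fun w w' hw => by simpa using hw⟩, ?_⟩, ?_, ?_⟩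
    · intro w w'
      change G.Adj (f (u + w)) (f (u + w')) ↔ _
      rw [f.map_adj_iff, SimpleGraph.cycleGraph_adj', SimpleGraph.cycleGraph_adj',
        add_sub_add_left_eq_sub, add_sub_add_left_eq_sub]
    · exact congrArg f (add_zero u)
    · change f (u + _) = _
      rw [hlast, ← hone _ h]
      congr 1
      abel
  · refine ⟨⟨⟨fun w => f (u - w), fun w w' hw => by simpa using hw⟩, ?_⟩, ?_, ?_⟩
    · intro w w'
      change G.Adj (f (u - w)) (f (u - w')) ↔ _
      rw [f.map_adj_iff, SimpleGraph.cycleGraph_adj', SimpleGraph.cycleGraph_adj',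
        sub_sub_sub_cancel_left, sub_sub_sub_cancel_left, or_comm]
    · exact congrArg f (sub_zero u)
    · change f (u - _) = _
      rw [hlast, ← hone _ h]
      congr 1
      abel

lemma exists_cycle_embedding_zero {G : SimpleGraph V} {n : ℕ} [NeZero n]
    (f : SimpleGraph.cycleGraph n ↪g G) (u v : Fin n) :
    ∃ f' : SimpleGraph.cycleGraph n ↪g G, f' 0 = f u ∧ f' (v - u) = f v := by
  refine ⟨⟨⟨fun w => f (w + u), fun w w' hw => by simpa using hw⟩, ?_⟩,
    congrArg f (zero_add u), congrArg f (sub_add_cancel v u)⟩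
  intro w w'
  change G.Adj (f (w + u)) (f (w' + u)) ↔ _
  rw [f.map_adj_iff, SimpleGraph.cycleGraph_adj', SimpleGraph.cycleGraph_adj',
    add_sub_add_right_eq_sub, add_sub_add_right_eq_sub]

lemma hasInducedCycleLen_five_of_compl {G : SimpleGraph V} (h : HasInducedCycleLen Gᶜ 5) :
    HasInducedCycleLen G 5 := by
  rw [hasInducedCycleLen_iff] at h ⊢
  obtain ⟨f⟩ := h
  refine ⟨⟨⟨fun i => f (2 * i), fun i j hij => ?_⟩, ?_⟩⟩
  · have := f.injective hij
    clear hij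
    revert i j
    decide
  · intro i j
    have h1 := f.map_adj_iff (v := 2 * i) (w := 2 * j)
    have h2 : f (2 * i) = f (2 * j) ↔ 2 * i = 2 * j := f.injective.eq_iff
    rw [G.compl_adj, SimpleGraph.cycleGraph_adj'] at h1
    change G.Adj (f (2 * i)) (f (2 * j)) ↔ _
    rw [SimpleGraph.cycleGraph_adj']
    have h3 : ((i - j).val = 1 ∨ (j - i).val = 1) ↔
        ¬ (2 * i = 2 * j) ∧ ¬ ((2 * i - 2 * j).val = 1 ∨ (2 * j - 2 * i).val = 1) := by
      clear h1 h2
      revert i j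
      decide
    rw [h3, ← h1, ← h2]
    have := fun h => G.ne_of_adj (a := f (2 * i)) (b := f (2 * j)) h
    tauto

lemma adj_sup_edge_iff {G : SimpleGraph V} {a b : V} (hab : a ≠ b) (x y : V) :
    (G ⊔ SimpleGraph.edge a b).Adj x y ↔ G.Adj x y ∨ (x = a ∧ y = b) ∨ (x = b ∧ y = a) := by
  rw [SimpleGraph.sup_adj, SimpleGraph.edge_adj]
  constructor
  · rintro (h | ⟨⟨rfl, rfl⟩ | ⟨rfl, rfl⟩, -⟩) <;> simp [*]
  · rintro (h | ⟨rfl, rfl⟩ | ⟨rfl, rfl⟩) <;> simp [*, hab.symm]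

lemma IsTwoPair.adj_iff {G : SimpleGraph V} {U : Set V} {a b : V} (h : IsTwoPair G U a b)
    (x y : V) : G.Adj x y ↔
      (G ⊔ SimpleGraph.edge a b).Adj x y ∧ ¬ (x = a ∧ y = b) ∧ ¬ (x = b ∧ y = a) := by
  rw [adj_sup_edge_iff h.1]
  have h2 : ¬ G.Adj b a := fun h' => h.2.1 h'.symm
  constructor
  · intro hxy
    refine ⟨.inl hxy, ?_, ?_⟩
    · rintro ⟨rfl, rfl⟩; exact h.2.1 hxy
    · rintro ⟨rfl, rfl⟩; exact h2 hxy
  · tauto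

lemma IsTwoPair.hasInducedCycleLen_of_sup_edge {G : SimpleGraph V} {a b : V}
    (h : IsTwoPair G Set.univ a b) {n : ℕ} (hn : 5 ≤ n)
    (hc : HasInducedCycleLen (G ⊔ SimpleGraph.edge a b) n) : HasInducedCycleLen G n := by
  rw [hasInducedCycleLen_iff] at hc ⊢
  obtain ⟨f⟩ := hc
  by_cases hab : ∃ u v, f u = a ∧ f v = b
  · exfalso
    obtain ⟨u, v, hu, hv⟩ := hab
    obtain ⟨n, rfl⟩ := Nat.exists_eq_add_of_le' (show 2 ≤ n by omega)
    obtain ⟨g, hg0, hgl⟩ := exists_cycle_embedding_ends f (u := u) (v := v)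
      (f.map_adj_iff.1 (by rw [hu, hv, adj_sup_edge_iff h.1]; simp))
    have hval : ∀ i ≤ n + 1, (Fin.ofNat (n + 2) i).val = i := fun i hi =>
      Nat.mod_eq_of_lt (by omega)
    refine absurd (h.2.2 (fun i => g (Fin.ofNat (n + 2) i)) (n + 1) (by omega)
      ⟨fun i hi j hj hij => ?_, fun i hi j hj => ?_⟩ ?_ ?_) (by simp)
    · rw [← hval i hi, ← hval j hj, g.injective hij]
    · have e1 : ∀ i ≤ n + 1, (g (Fin.ofNat (n + 2) i) = a ↔ i = 0) := fun i hi => by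
        have := g.injective.eq_iff (a := Fin.ofNat _ i) (b := 0)
        rw [hg0.trans hu, Fin.ext_iff, hval i hi] at this
        exact this
      have e2 : ∀ i ≤ n + 1, (g (Fin.ofNat (n + 2) i) = b ↔ i = n + 1) := fun i hi => by
        have := g.injective.eq_iff (a := Fin.ofNat _ i) (b := Fin.last _)
        rw [hgl.trans hv, Fin.ext_iff, hval i hi] at this
        exact this
      rw [h.adj_iff, g.map_adj_iff, cycleGraph_adj_val (by omega), hval i hi, hval j hj,
        e1 i hi, e1 j hj, e2 i hi, e2 j hj]
      omega
    · exact hg0.trans hu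
    · exact (congrArg g (Fin.ext (hval _ le_rfl))).trans (hgl.trans hv)
  · push Not at hab
    refine ⟨⟨f.toEmbedding, ?_⟩⟩
    intro u v
    change G.Adj (f u) (f v) ↔ _
    rw [h.adj_iff, f.map_adj_iff]
    have h1 := hab u v
    have h2 := hab v u
    tauto

lemma IsTwoPair.hasInducedCycleLen_compl_of_sup_edge {G : SimpleGraph V} {a b : V}
    (h : IsTwoPair G Set.univ a b) {n : ℕ} (hn : 6 ≤ n)
    (hc : HasInducedCycleLen (G ⊔ SimpleGraph.edge a b)ᶜ n) : HasInducedCycleLen Gᶜ n := by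
  rw [hasInducedCycleLen_iff] at hc ⊢
  obtain ⟨f⟩ := hc
  by_cases hab : ∃ u v, f u = a ∧ f v = b
  · exfalso
    obtain ⟨u, v, hu, hv⟩ := hab
    have : NeZero n := ⟨by omega⟩
    obtain ⟨g, hg0, hgl⟩ := exists_cycle_embedding_zero f u v
    set j := (v - u).val with hj
    have hjn : j < n := (v - u).2
    have hval : ∀ i < n, (Fin.ofNat n i).val = i := fun i hi => Nat.mod_eq_of_lt (by omega)
    have hgj : g (Fin.ofNat n j) = b := by
      rw [show Fin.ofNat n j = v - u from Fin.ext (hval _ hjn)]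
      exact hgl.trans hv
    have e1 : ∀ i < n, (g (Fin.ofNat n i) = a ↔ i = 0) := fun i hi => by
      have := g.injective.eq_iff (a := Fin.ofNat _ i) (b := 0)
      rw [hg0.trans hu, Fin.ext_iff, hval i hi] at this
      exact this
    have e2 : ∀ i < n, (g (Fin.ofNat n i) = b ↔ i = j) := fun i hi => by
      have := g.injective.eq_iff (a := Fin.ofNat n i) (b := Fin.ofNat n j)
      rwa [hgj, Fin.ext_iff, hval i hi, hval j hjn] at this
    have hadj : ∀ i < n, ∀ i' < n, (G.Adj (g (Fin.ofNat n i)) (g (Fin.ofNat n i')) ↔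
        i ≠ i' ∧ ¬ ((i + 1 = i' ∨ i' + 1 = i) ∨ (i = 0 ∧ i' + 1 = n) ∨ (i' = 0 ∧ i + 1 = n)) ∧
          ¬ (i = 0 ∧ i' = j) ∧ ¬ (i = j ∧ i' = 0)) := by
      intro i hi i' hi'
      have h1 := g.map_adj_iff (v := Fin.ofNat n i) (w := Fin.ofNat n i')
      rw [SimpleGraph.compl_adj, cycleGraph_adj_val (by omega), hval i hi, hval i' hi', ne_eq,
        g.injective.eq_iff, Fin.ext_iff, hval i hi, hval i' hi'] at h1
      rw [h.adj_iff, e1 i hi, e1 i' hi', e2 i hi, e2 i' hi', ← h1]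
      have h2 : (G ⊔ SimpleGraph.edge a b).Adj (g (Fin.ofNat n i)) (g (Fin.ofNat n i')) →
          i ≠ i' := by
        rintro h' rfl
        exact SimpleGraph.irrefl _ h'
      by_cases h3 : (G ⊔ SimpleGraph.edge a b).Adj (g (Fin.ofNat n i)) (g (Fin.ofNat n i'))
      · simp only [h3, h2 h3, ne_eq, not_false_iff, not_true, and_false, true_and]
      · simp only [h3, not_false_iff, and_true, not_not, false_and, false_iff]
        tauto
    have hj2 : 2 ≤ j ∧ j + 2 ≤ n := by
      have h1 := g.map_adj_iff (v := Fin.ofNat n 0) (w := Fin.ofNat n j)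
      rw [SimpleGraph.compl_adj, cycleGraph_adj_val (by omega), hval 0 (by omega), hval j hjn,
        (e1 0 (by omega)).2 rfl, hgj, adj_sup_edge_iff h.1] at h1
      have h3 : j ≠ 0 := by
        intro h0
        have := (e1 j hjn).2 h0
        exact h.1 (this.symm.trans hgj)
      have h4 : ¬ (((0 + 1 = j ∨ j + 1 = 0) ∨ (0 = 0 ∧ j + 1 = n) ∨ (j = 0 ∧ 0 + 1 = n))) := by
        rw [← h1]; simp
      omega
    have key : ∀ x y, (x < n ∧ y < n ∧ 0 < x ∧ 0 < y ∧ x ≠ y ∧ x ≠ j ∧ y ≠ j) →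
        (2 ≤ x ∧ x + 1 < n) → (x + 1 < y ∨ y + 1 < x) → (y + 1 < j ∨ j + 1 < y) →
        (y = 1 ∨ y + 1 = n) → (x + 1 = j ∨ j + 1 = x) → False := by
      intro x y h1 h2 h3 h4 h5 h6
      refine absurd (h.2.2 (fun i => g (Fin.ofNat n
        (if i = 0 then 0 else if i = 1 then x else if i = 2 then y else j))) 3 le_rfl
        ⟨fun i hi i' hi' hii => ?_, fun i hi i' hi' => ?_⟩ ?_ ?_) (by simp)
      · have h7 := congrArg Fin.val (g.injective hii)
        rw [hval _ (by split_ifs <;> omega), hval _ (by split_ifs <;> omega)] at h7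
        split_ifs at h7 <;> omega
      · rw [hadj _ (by split_ifs <;> omega) _ (by split_ifs <;> omega)]
        split_ifs <;> first | omega | (simp only [false_or, or_false]; omega)
      · exact hg0.trans hu
      · exact hgj
    by_cases h4 : 4 ≤ j
    · exact key (j - 1) 1 (by omega) (by omega) (by omega) (by omega) (by omega) (by omega)
    by_cases h5 : j + 4 ≤ n
    · exact key (j + 1) (n - 1) (by omega) (by omega) (by omega) (by omega) (by omega) (by omega)
    exact key (j + 1) 1 (by omega) (by omega) (by omega) (by omega) (by omega) (by omega)
  · push Not at hab
    refine ⟨⟨f.toEmbedding, ?_⟩⟩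
    intro u v
    change Gᶜ.Adj (f u) (f v) ↔ _
    rw [← f.map_adj_iff, SimpleGraph.compl_adj, SimpleGraph.compl_adj, h.adj_iff]
    have h1 := hab u v
    have h2 := hab v u
    tauto

/-- Joining a two-pair of a weakly chordal graph by an edge gives a weakly chordal graph. -/
lemma IsTwoPair.weaklyChordal_sup_edge {G : SimpleGraph V} {a b : V}
    (h : IsTwoPair G Set.univ a b) (hG : WeaklyChordal G) :
    WeaklyChordal (G ⊔ SimpleGraph.edge a b) := by
  have h1 : ∀ n : ℕ, 5 ≤ n → ¬ HasInducedCycleLen (G ⊔ SimpleGraph.edge a b) n :=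
    fun n hn hc => hG.1 n hn (h.hasInducedCycleLen_of_sup_edge hn hc)
  refine ⟨h1, fun n hn hc => ?_⟩
  rcases Nat.lt_or_ge 5 n with h6 | h5
  · exact hG.2 n hn (h.hasInducedCycleLen_compl_of_sup_edge h6 hc)
  · obtain rfl : n = 5 := by omega
    exact h1 5 le_rfl (hasInducedCycleLen_five_of_compl hc)

/-- The common neighbours of a two-pair separate it. -/
lemma IsTwoPair.not_reflTransGen {G : SimpleGraph V} {a b : V} (h : IsTwoPair G Set.univ a b) :
    ¬ Relation.ReflTransGen (fun u v => G.Adj u v ∧ v ∈ {v | ¬ (G.Adj a v ∧ G.Adj b v)}) a b := by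
  intro hr
  obtain ⟨k, p, h0, hk, hp, hpT⟩ := exists_isIndPath_of_reflTransGen hr
  rcases Nat.lt_or_ge 2 k with h2 | h2
  · obtain ⟨i, -, hi⟩ := h.2.2 p k h2 hp h0 hk
    exact hi (Set.mem_univ _)
  · have : k = 0 ∨ k = 1 ∨ k = 2 := by omega
    rcases this with rfl | rfl | rfl
    · exact h.1 (h0.symm.trans hk)
    · exact h.2.1 (by rw [← h0, ← hk]; exact (hp.2 0 (by omega) 1 (by omega)).2 (by omega))
    · refine hpT 1 le_rfl (by omega) ⟨?_, ?_⟩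
      · rw [← h0]; exact (hp.2 0 (by omega) 1 (by omega)).2 (by omega)
      · rw [← hk]; exact (hp.2 2 (by omega) 1 (by omega)).2 (by omega)

end Graph

section Divisibility

variable {ℓ : ℕ}

/-- The substitution `x_b ↦ x_a`. -/
noncomputable def subst (a b : Fin ℓ) : Spoly ℓ →ₐ[ℚ] Spoly ℓ := rename (Function.update id b a)

@[simp]
lemma subst_X_self (a b : Fin ℓ) : subst a b (X b) = X a := by simp [subst]

lemma subst_X_of_ne {a b v : Fin ℓ} (h : v ≠ b) : subst a b (X v) = X v := by
  simp [subst, Function.update_of_ne h]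

@[simp]
lemma subst_X_left (a b : Fin ℓ) : subst a b (X a) = X a := by
  by_cases h : a = b
  · subst h; simp
  · exact subst_X_of_ne h

lemma sub_rename_mem (I : Ideal (Spoly ℓ)) (s : Fin ℓ → Fin ℓ)
    (h : ∀ i, (X i - X (s i) : Spoly ℓ) ∈ I) (g : Spoly ℓ) : g - rename s g ∈ I := by
  have : (Ideal.Quotient.mkₐ ℚ I).comp (rename s) = Ideal.Quotient.mkₐ ℚ I := by
    ext i
    simp only [AlgHom.comp_apply, rename_X, Ideal.Quotient.mkₐ_eq_mk]
    exact (Ideal.Quotient.eq.2 (h i)).symm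
  rw [← Ideal.Quotient.eq]
  exact (DFunLike.congr_fun this g).symm

lemma dvd_sub_subst (a b : Fin ℓ) (f : Spoly ℓ) : (X a - X b) ∣ f - subst a b f := by
  rw [← Ideal.mem_span_singleton]
  refine sub_rename_mem _ _ (fun i => ?_) f
  by_cases h : i = b
  · subst h
    rw [Function.update_self, Ideal.mem_span_singleton]
    exact ⟨-1, by ring⟩
  · simp [Function.update_of_ne h]

lemma X_sub_X_dvd_iff {a b : Fin ℓ} {f : Spoly ℓ} : (X a - X b) ∣ f ↔ subst a b f = 0 := by
  constructor
  · rintro ⟨g, rfl⟩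
    simp
  · intro h
    simpa [h] using dvd_sub_subst a b f

lemma X_sub_X_ne_zero {a b : Fin ℓ} (h : a ≠ b) : (X a - X b : Spoly ℓ) ≠ 0 :=
  sub_ne_zero.2 fun h' => h (X_injective h')

lemma prime_X_sub_X {a b : Fin ℓ} (h : a ≠ b) : Prime (X a - X b : Spoly ℓ) := by
  refine ⟨X_sub_X_ne_zero h, fun hu => ?_, fun f g hfg => ?_⟩
  · have := X_sub_X_dvd_iff.1 (hu.dvd (a := 1))
    simp at this
  · simpa only [X_sub_X_dvd_iff, map_mul, mul_eq_zero] using hfg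

lemma not_X_sub_X_dvd {a b c d : Fin ℓ} (hcb : c ≠ b) (hdb : d ≠ b) (hcd : c ≠ d) :
    ¬ (X a - X b : Spoly ℓ) ∣ X c - X d := by
  rw [X_sub_X_dvd_iff, map_sub, subst_X_of_ne hcb, subst_X_of_ne hdb]
  exact X_sub_X_ne_zero hcd

lemma prod_X_sub_X_dvd {a : Fin ℓ} {N : Finset (Fin ℓ)} (ha : a ∉ N) {h : Spoly ℓ}
    (hN : ∀ v ∈ N, (X a - X v) ∣ h) : ∏ v ∈ N, (X a - X v) ∣ h := by
  refine Finset.prod_dvd_of_isRelPrime (fun v hv w hw hvw => ?_) hN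
  have hav : a ≠ v := fun h => ha (h ▸ hv)
  have haw : a ≠ w := fun h => ha (h ▸ hw)
  exact (prime_X_sub_X hav).irreducible.isRelPrime_iff_not_dvd.2
    (not_X_sub_X_dvd hav hvw.symm haw)

lemma sub_dvd_prod_sub_prod (N : Finset (Fin ℓ)) (f g : Spoly ℓ) :
    f - g ∣ ∏ c ∈ N, (f - X c) - ∏ c ∈ N, (g - X c) := by
  have := Polynomial.sub_dvd_eval_sub f g (∏ c ∈ N, (Polynomial.X - Polynomial.C (X c)))
  simpa [Polynomial.eval_prod] using this

end Divisibility

section LogFun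

variable {ℓ : ℕ}

/-- The coordinate description of `logDer ℓ G`: a derivation is given by its values on the
variables. -/
noncomputable def logFun (G : SimpleGraph (Fin ℓ)) : Submodule (Spoly ℓ) (Fin ℓ → Spoly ℓ) where
  carrier := {f | ∀ i j, G.Adj i j → (X i - X j) ∣ f i - f j}
  add_mem' := fun {f g} hf hg i j h => by
    rw [Pi.add_apply, Pi.add_apply, add_sub_add_comm]
    exact dvd_add (hf i j h) (hg i j h)
  zero_mem' := fun i j _ => by simp
  smul_mem' := fun c f hf i j h => by
    rw [Pi.smul_apply, Pi.smul_apply, ← smul_sub]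
    exact (hf i j h).mul_left c

/-- Derivations in `logDer ℓ G` correspond to their coordinate vectors. -/
noncomputable def logDerEquiv (G : SimpleGraph (Fin ℓ)) : logDer ℓ G ≃ₗ[Spoly ℓ] logFun G where
  toFun θ := ⟨fun i => θ.1 (X i), θ.2⟩
  map_add' _ _ := rfl
  map_smul' _ _ := rfl
  invFun f := ⟨mkDerivation ℚ f.1, fun i j h => by
    simpa only [mkDerivation_X] using f.2 i j h⟩
  left_inv θ := Subtype.ext (derivation_ext fun i => mkDerivation_X ℚ _ i)
  right_inv f := Subtype.ext (funext fun i => mkDerivation_X ℚ _ i)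

/-- Common neighbours of `a` and `b` divide the difference of the values at `a` and `b` after
identifying `x_b` with `x_a`. -/
lemma prod_dvd_subst_sub {G : SimpleGraph (Fin ℓ)} {f : Fin ℓ → Spoly ℓ} (hf : f ∈ logFun G)
    {a b : Fin ℓ} {N : Finset (Fin ℓ)} (hN : ∀ v ∈ N, G.Adj a v ∧ G.Adj b v) :
    ∏ v ∈ N, (X a - X v) ∣ subst a b (f a - f b) := by
  refine prod_X_sub_X_dvd (fun h => G.irrefl (hN a h).1) fun v hv => ?_
  obtain ⟨hav, hbv⟩ := hN v hv
  obtain ⟨g, hg⟩ := hf a v hav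
  obtain ⟨h, hh⟩ := hf b v hbv
  have : f a - f b = (X a - X v) * g - (X b - X v) * h := by rw [← hg, ← hh]; ring
  rw [this]
  simp only [map_sub, map_mul, subst_X_left, subst_X_self, subst_X_of_ne (G.ne_of_adj hbv).symm]
  rw [← mul_sub]
  exact dvd_mul_right _ _

end LogFun

section ShortResolutionTransfer

variable {R : Type} [CommRing R] {M N : Type} [AddCommGroup M] [Module R M]
  [AddCommGroup N] [Module R N]

lemma HasShortResolution.of_equiv (e : M ≃ₗ[R] N) (h : HasShortResolution (R := R) M) :
    HasShortResolution (R := R) N := by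
  obtain ⟨P, _, _, p, hP, hp, hK⟩ := h
  refine ⟨P, inferInstance, inferInstance, e.toLinearMap ∘ₗ p, hP, e.surjective.comp hp, ?_⟩
  rwa [LinearEquiv.ker_comp]

lemma HasShortResolution.of_projective (h : Module.Projective R M) :
    HasShortResolution (R := R) M := by
  refine ⟨M, inferInstance, inferInstance, LinearMap.id, h, Function.surjective_id, ?_⟩
  rw [LinearMap.ker_id]
  infer_instance

/-- If `N` is generated by a submodule `M` with a short resolution together with one element `e`
whose multiples in `M` are those of `α • e`, then `N` has a short resolution. -/
lemma HasShortResolution.of_adjoin [IsDomain R] (h : HasShortResolution (R := R) M)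
    (ι : M →ₗ[R] N) (hι : Function.Injective ι) (e : N) {α : R} (hα : α ≠ 0)
    (hmem : α • e ∈ LinearMap.range ι) (hgen : ∀ f, ∃ d, ∃ c : R, f = ι d + c • e)
    (hdvd : ∀ c : R, c • e ∈ LinearMap.range ι → α ∣ c) : HasShortResolution (R := R) N := by
  obtain ⟨P, _, _, p, hP, hp, hK⟩ := h
  obtain ⟨d₀, hd₀⟩ := hmem
  obtain ⟨u₀, rfl⟩ := hp d₀
  let q : P × R →ₗ[R] N := (ι ∘ₗ p).coprod (LinearMap.toSpanSingleton R N e)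
  have hq : ∀ x, q x = ι (p x.1) + x.2 • e := fun x => rfl
  let k : LinearMap.ker p × R →ₗ[R] P × R :=
    ((LinearMap.ker p).subtype ∘ₗ LinearMap.fst R _ _ -
      LinearMap.toSpanSingleton R P u₀ ∘ₗ LinearMap.snd R _ _).prod (α • LinearMap.snd R _ _)
  have hk : ∀ x, k x = ((x.1 : P) - x.2 • u₀, α * x.2) := fun x => rfl
  have hmem : ∀ x, k x ∈ LinearMap.ker q := fun x => by
    rw [LinearMap.mem_ker, hq, hk]
    have := x.1.2
    rw [LinearMap.mem_ker] at this
    simp only [map_sub, map_smul, this, hd₀, smul_smul, mul_comm α]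
    simp
  refine ⟨P × R, inferInstance, inferInstance, q, inferInstance, fun f => ?_, ?_⟩
  · obtain ⟨d, c, rfl⟩ := hgen f
    obtain ⟨u, rfl⟩ := hp d
    exact ⟨(u, c), rfl⟩
  · refine Module.Projective.of_equiv (LinearEquiv.ofBijective (k.codRestrict _ hmem) ⟨?_, ?_⟩)
    · rw [← LinearMap.ker_eq_bot, LinearMap.ker_codRestrict, LinearMap.ker_eq_bot']
      rintro ⟨x, d⟩ h
      rw [hk, Prod.mk_eq_zero] at h
      obtain rfl : d = 0 := (mul_eq_zero.1 h.2).resolve_left hα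
      simpa using h.1
    · rintro ⟨⟨u, c⟩, h⟩
      rw [LinearMap.mem_ker, hq] at h
      obtain ⟨d, rfl⟩ := hdvd c ⟨-p u, by rw [map_neg, neg_eq_iff_add_eq_zero]; exact h⟩
      refine ⟨(⟨u + d • u₀, ?_⟩, d), Subtype.ext ?_⟩
      · rw [LinearMap.mem_ker]
        apply hι
        rw [map_zero, map_add, map_add, map_smul, map_smul, hd₀, smul_smul, mul_comm d]
        exact h
      · change k _ = _
        rw [hk]
        simp

end ShortResolutionTransfer

section Sufficiency

variable {ℓ : ℕ}

/-- Logarithmic vectors of the complete graph on the vertex set `T`, supported on `T`. -/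
noncomputable def cliqueFun (T : Finset (Fin ℓ)) : Submodule (Spoly ℓ) (Fin ℓ → Spoly ℓ) where
  carrier := {f | (∀ i ∉ T, f i = 0) ∧ ∀ i ∈ T, ∀ j ∈ T, (X i - X j) ∣ f i - f j}
  add_mem' := fun {f g} hf hg => ⟨fun i hi => by simp [hf.1 i hi, hg.1 i hi],
    fun i hi j hj => by
      rw [Pi.add_apply, Pi.add_apply, add_sub_add_comm]
      exact dvd_add (hf.2 i hi j hj) (hg.2 i hi j hj)⟩
  zero_mem' := ⟨fun i _ => rfl, fun i _ j _ => by simp⟩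
  smul_mem' := fun c f hf => ⟨fun i hi => by simp [hf.1 i hi], fun i hi j hj => by
    rw [Pi.smul_apply, Pi.smul_apply, ← smul_sub]
    exact (hf.2 i hi j hj).mul_left c⟩

lemma projective_cliqueFun (T : Finset (Fin ℓ)) : Module.Projective (Spoly ℓ) (cliqueFun T) := by
  induction T using Finset.induction_on with
  | empty =>
    have : Subsingleton (cliqueFun (∅ : Finset (Fin ℓ))) :=
      ⟨fun f g => Subtype.ext (funext fun i => by
        rw [f.2.1 i (Finset.notMem_empty i), g.2.1 i (Finset.notMem_empty i)])⟩
    exact Module.Projective.of_free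
  | insert a T ha ih =>
    let φ : Spoly ℓ × cliqueFun T →ₗ[Spoly ℓ] (Fin ℓ → Spoly ℓ) :=
      { toFun := fun x i => if i ∈ insert a T then x.1 + (X i - X a) * x.2.1 i else 0
        map_add' := fun x y => by
          funext i
          simp only [Pi.add_apply, Prod.fst_add, Prod.snd_add, Submodule.coe_add]
          split_ifs <;> ring
        map_smul' := fun c x => by
          funext i
          simp only [Pi.smul_apply, Prod.smul_fst, Prod.smul_snd, Submodule.coe_smul,
            smul_eq_mul, RingHom.id_apply]
          split_ifs <;> ring }
    have hφ : ∀ x, ∀ i ∈ insert a T, φ x i = x.1 + (X i - X a) * x.2.1 i :=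
      fun x i hi => if_pos hi
    have hmem : ∀ x, φ x ∈ cliqueFun (insert a T) := by
      rintro ⟨c, g⟩
      refine ⟨fun i hi => if_neg hi, fun i hi j hj => ?_⟩
      rw [hφ _ i hi, hφ _ j hj]
      have e1 : c + (X i - X a) * g.1 i - (c + (X j - X a) * g.1 j) =
          (X i - X j) * g.1 i + (X j - X a) * (g.1 i - g.1 j) := by ring
      have e2 : c + (X i - X a) * g.1 i - (c + (X j - X a) * g.1 j) =
          (X i - X a) * (g.1 i - g.1 j) + (X i - X j) * g.1 j := by ring
      rcases Finset.mem_insert.1 hi with rfl | hi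
      · rw [e2, sub_self, zero_mul, zero_add]
        exact dvd_mul_right _ _
      rcases Finset.mem_insert.1 hj with rfl | hj
      · rw [e1, sub_self, zero_mul, add_zero]
        exact dvd_mul_right _ _
      rw [e1]
      exact dvd_add (dvd_mul_right _ _) ((g.2.2 i hi j hj).mul_left _)
    refine Module.Projective.of_equiv (LinearEquiv.ofBijective (φ.codRestrict _ hmem) ⟨?_, ?_⟩)
    · rw [← LinearMap.ker_eq_bot, LinearMap.ker_codRestrict, LinearMap.ker_eq_bot']
      rintro ⟨c, g⟩ h
      have hc : c = 0 := by
        have := congrFun h a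
        rw [hφ _ a (Finset.mem_insert_self a T)] at this
        simpa using this
      subst hc
      refine Prod.ext rfl (Subtype.ext (funext fun i => ?_))
      by_cases hi : i ∈ T
      · have := congrFun h i
        rw [hφ _ i (Finset.mem_insert_of_mem hi)] at this
        simp only [zero_add, Pi.zero_apply, mul_eq_zero] at this
        exact this.resolve_left (X_sub_X_ne_zero fun h : i = a => ha (h ▸ hi))
      · exact g.2.1 i hi
    · rintro ⟨f, hf0, hf⟩
      have : ∀ i, ∃ g, (i ∈ T → f i - f a = (X i - X a) * g) ∧ (i ∉ T → g = 0) := by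
        intro i
        by_cases hi : i ∈ T
        · obtain ⟨g, hg⟩ := hf i (Finset.mem_insert_of_mem hi) a (Finset.mem_insert_self a T)
          exact ⟨g, fun _ => hg, fun h => absurd hi h⟩
        · exact ⟨0, fun h => absurd h hi, fun _ => rfl⟩
      choose g hg hg0 using this
      refine ⟨(f a, ⟨g, hg0, fun i hi j hj => ?_⟩), Subtype.ext (funext fun i => ?_)⟩
      · by_cases hij : i = j
        · simp [hij]
        have h1 : (X i - X j) ∣ (X j - X a) * (g i - g j) := by
          have h2 : (X j - X a) * (g i - g j) = (f i - f j) - (X i - X j) * g i := by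
            linear_combination hg j hj - hg i hi
          rw [h2]
          exact dvd_sub (hf i (Finset.mem_insert_of_mem hi) j (Finset.mem_insert_of_mem hj))
            (dvd_mul_right _ _)
        refine ((prime_X_sub_X hij).dvd_or_dvd h1).resolve_left ?_
        rw [X_sub_X_dvd_iff, map_sub, subst_X_self, subst_X_of_ne fun h : a = j => ha (h ▸ hj)]
        exact X_sub_X_ne_zero fun h : i = a => ha (h ▸ hi)
      · change φ _ i = f i
        by_cases hi : i ∈ insert a T
        · rw [hφ _ i hi]
          rcases Finset.mem_insert.1 hi with rfl | hi
          · simp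
          · simp only
            linear_combination -hg i hi
        · rw [hf0 i hi]
          exact if_neg hi

lemma projective_logFun_of_complete {G : SimpleGraph (Fin ℓ)} (hG : ∀ a b, a ≠ b → G.Adj a b) :
    Module.Projective (Spoly ℓ) (logFun G) := by
  have h : cliqueFun Finset.univ = logFun G := by
    ext f
    constructor
    · exact fun hf i j _ => hf.2 i (Finset.mem_univ _) j (Finset.mem_univ _)
    · refine fun hf => ⟨fun i hi => absurd (Finset.mem_univ i) hi, fun i _ j _ => ?_⟩
      by_cases hij : i = j
      · simp [hij]
      · exact hf i j (hG i j hij)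
  exact h ▸ projective_cliqueFun Finset.univ

lemma IsTwoPair.hasShortResolution {G : SimpleGraph (Fin ℓ)} {a b : Fin ℓ}
    (hab : IsTwoPair G Set.univ a b)
    (h : HasShortResolution (R := Spoly ℓ) (logFun (G ⊔ SimpleGraph.edge a b))) :
    HasShortResolution (R := Spoly ℓ) (logFun G) := by
  classical
  let N : Finset (Fin ℓ) := Finset.univ.filter fun v => G.Adj a v ∧ G.Adj b v
  have hN : ∀ v, v ∈ N ↔ G.Adj a v ∧ G.Adj b v := fun v => by simp [N]
  let A : Set (Fin ℓ) := {x | Relation.ReflTransGen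
    (fun u v => G.Adj u v ∧ v ∈ {v | ¬ (G.Adj a v ∧ G.Adj b v)}) a x}
  have haA : a ∈ A := Relation.ReflTransGen.refl
  have hbA : b ∉ A := hab.not_reflTransGen
  have hstep : ∀ u ∈ A, ∀ v ∉ A, G.Adj u v → v ∈ N := fun u hu v hv huv => by
    by_contra hcon
    exact hv (Relation.ReflTransGen.tail hu ⟨huv, fun h => hcon ((hN v).2 h)⟩)
  let e : Fin ℓ → Spoly ℓ := fun v => if v ∈ A then ∏ c ∈ N, (X v - X c) else 0
  have heA : ∀ v ∈ A, e v = ∏ c ∈ N, (X v - X c) := fun v hv => if_pos hv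
  have heA' : ∀ v ∉ A, e v = 0 := fun v hv => if_neg hv
  have hdvdN : ∀ u, ∀ v ∈ N, (X u - X v : Spoly ℓ) ∣ ∏ c ∈ N, (X u - X c) := fun u v hv =>
    Finset.dvd_prod_of_mem (fun c => (X u - X c : Spoly ℓ)) hv
  have he : e ∈ logFun G := by
    intro u v huv
    by_cases hu : u ∈ A <;> by_cases hv : v ∈ A
    · rw [heA u hu, heA v hv]
      exact sub_dvd_prod_sub_prod N _ _
    · rw [heA u hu, heA' v hv, sub_zero]
      exact hdvdN u v (hstep u hu v hv huv)
    · rw [heA' u hu, heA v hv, zero_sub, ← neg_sub, neg_dvd, dvd_neg]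
      exact hdvdN v u (hstep v hv u hu huv.symm)
    · simp [heA' u hu, heA' v hv]
  have hle : logFun (G ⊔ SimpleGraph.edge a b) ≤ logFun G :=
    fun f hf i j hij => hf i j (Or.inl hij)
  have hmem : ∀ f, f ∈ logFun (G ⊔ SimpleGraph.edge a b) ↔
      f ∈ logFun G ∧ (X a - X b) ∣ f a - f b := by
    refine fun f => ⟨fun hf => ⟨hle hf, hf a b ?_⟩, fun hf i j hij => ?_⟩
    · rw [adj_sup_edge_iff hab.1]; simp
    · rcases (adj_sup_edge_iff hab.1 i j).1 hij with h | ⟨rfl, rfl⟩ | ⟨rfl, rfl⟩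
      · exact hf.1 i j h
      · exact hf.2
      · rw [← neg_sub, ← neg_sub (f j), neg_dvd, dvd_neg]
        exact hf.2
  have hrange : ∀ f : logFun G, f ∈ LinearMap.range (Submodule.inclusion hle) ↔
      (X a - X b) ∣ f.1 a - f.1 b := by
    intro f
    rw [Submodule.range_inclusion, Submodule.mem_comap, hmem]
    exact ⟨fun h => h.2, fun h => ⟨f.2, h⟩⟩
  refine h.of_adjoin (Submodule.inclusion hle) (Submodule.inclusion_injective hle) ⟨e, he⟩
    (X_sub_X_ne_zero hab.1) ((hrange _).2 ?_) (fun f => ?_) (fun c hc => ?_)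
  · change _ ∣ (X a - X b) * e a - (X a - X b) * e b
    rw [← mul_sub]
    exact dvd_mul_right _ _
  · obtain ⟨c, hc⟩ := prod_dvd_subst_sub f.2 (a := a) (b := b) (N := N) fun v hv => (hN v).1 hv
    have : f - c • ⟨e, he⟩ ∈ LinearMap.range (Submodule.inclusion hle) := by
      rw [hrange]
      change _ ∣ (f.1 a - c * e a) - (f.1 b - c * e b)
      have h2 : (f.1 a - c * e a) - (f.1 b - c * e b) =
          (f.1 a - f.1 b) - subst a b (f.1 a - f.1 b) := by
        rw [hc, heA a haA, heA' b hbA]; ring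
      rw [h2]
      exact dvd_sub_subst a b _
    obtain ⟨d, hd⟩ := this
    exact ⟨d, c, by rw [hd]; simp⟩
  · have hc := (hrange _).1 hc
    change _ ∣ c * e a - c * e b at hc
    rw [heA' b hbA, mul_zero, sub_zero, heA a haA] at hc
    refine ((prime_X_sub_X hab.1).dvd_or_dvd hc).resolve_right fun hd => ?_
    obtain ⟨v, hv, hdv⟩ := (prime_X_sub_X hab.1).exists_mem_finset_dvd hd
    exact not_X_sub_X_dvd hab.1 (G.ne_of_adj ((hN v).1 hv).2).symm
      (G.ne_of_adj ((hN v).1 hv).1) hdv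

lemma WeaklyChordal.hasShortResolution {G : SimpleGraph (Fin ℓ)} (hG : WeaklyChordal G) :
    HasShortResolution (R := Spoly ℓ) (logFun G) := by
  induction G using (wellFounded_gt (α := SimpleGraph (Fin ℓ))).induction with
  | _ G ih =>
  by_cases hcomp : ∀ a b, a ≠ b → G.Adj a b
  · exact .of_projective (projective_logFun_of_complete hcomp)
  · push Not at hcomp
    obtain ⟨a, b, hne, hnadj⟩ := hcomp
    obtain ⟨a, -, b, -, h⟩ := hG.exists_isTwoPair Finset.univ
      ⟨a, Finset.mem_univ a, b, Finset.mem_univ b, hne, hnadj⟩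
    rw [Finset.coe_univ] at h
    refine h.hasShortResolution (ih _ ?_ (h.weaklyChordal_sup_edge hG))
    exact G.lt_sup_edge a b h.1 h.2.1

end Sufficiency

section ConstSyzygies

variable {R : Type} [CommRing R] {κ : Type} [Fintype κ]

/-- Modulo the ideal generated by the family `l`, every syzygy of `l` is a constant vector. -/
def HasConstSyzygies (l : κ → R) : Prop :=
  ∀ a : κ → R, ∑ i, l i * a i = 0 → ∀ i j, a i - a j ∈ Ideal.span (Set.range l)

lemma exists_sum_of_mem_span_smul_top {M : Type} [AddCommGroup M] [Module R M] (l : κ → R) {x : M}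
    (hx : x ∈ Ideal.span (Set.range l) • (⊤ : Submodule R M)) :
    ∃ s : κ → M, x = ∑ k, l k • s k := by
  induction hx using Submodule.smul_induction_on' with
  | smul r hr n _ =>
    obtain ⟨b, rfl⟩ := Ideal.mem_span_range_iff_exists_fun.1 hr
    refine ⟨fun k => b k • n, ?_⟩
    rw [Finset.sum_smul]
    exact Finset.sum_congr rfl fun k _ => by rw [smul_smul, mul_comm]
  | add x _ y _ hx hy =>
    obtain ⟨s, rfl⟩ := hx
    obtain ⟨t, rfl⟩ := hy
    exact ⟨s + t, by simp [Finset.sum_add_distrib]⟩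

lemma map_mem_smul_top {M N : Type} [AddCommGroup M] [Module R M] [AddCommGroup N] [Module R N]
    (φ : M →ₗ[R] N) {I : Ideal R} {x : M} (hx : x ∈ I • (⊤ : Submodule R M)) :
    φ x ∈ I • (⊤ : Submodule R N) := by
  have := Submodule.mem_map_of_mem (f := φ) hx
  rw [Submodule.map_smul''] at this
  exact Submodule.smul_mono le_rfl le_top this

lemma HasConstSyzygies.sub_mem {l : κ → R} (hl : HasConstSyzygies l) {P : Type} [AddCommGroup P]
    [Module R P] [hP : Module.Projective R P] (p : κ → P) (hp : ∑ i, l i • p i = 0) (i j : κ) :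
    p i - p j ∈ Ideal.span (Set.range l) • (⊤ : Submodule R P) := by
  obtain ⟨s, hs⟩ := Module.projective_def.1 hP
  have h1 : s (p i) - s (p j) ∈ Ideal.span (Set.range l) • (⊤ : Submodule R (P →₀ R)) := by
    rw [← Finsupp.sum_single (s (p i) - s (p j))]
    refine Submodule.sum_mem _ fun a _ => ?_
    have h2 := hl (fun k => s (p k) a) (by
      have := DFunLike.congr_fun (congrArg s hp) a
      simpa [Finsupp.finsetSum_apply] using this) i j
    have h3 : Finsupp.single a ((s (p i) - s (p j)) a) =
        (s (p i) a - s (p j) a) • Finsupp.single a (1 : R) := by simp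
    rw [h3]
    exact Submodule.smul_mem_smul h2 Submodule.mem_top
  have h4 := map_mem_smul_top (Finsupp.linearCombination R id) h1
  rwa [map_sub, hs, hs] at h4

/-- A necessary condition for a short resolution: second-order syzygies of the family `l` on
relations of `D` force certain elements into `(l) D`. -/
lemma HasShortResolution.sub_mem {l : κ → R} (hl : HasConstSyzygies l) {D : Type} [AddCommGroup D]
    [Module R D] (hD : HasShortResolution (R := R) D) {F : Type} [AddCommGroup F] [Module R F]
    [Module.Projective R F] (ψ : F →ₗ[R] D) (ρ : κ → F) (hψ : ∀ i, ψ (ρ i) = 0)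
    (hρ : ∑ i, l i • ρ i = 0) {i j : κ} (g : κ → F) (hg : ρ i - ρ j = ∑ k, l k • g k) (k k' : κ) :
    ψ (g k) - ψ (g k') ∈ Ideal.span (Set.range l) • (⊤ : Submodule R D) := by
  obtain ⟨P, _, _, p, hP, hp, hK⟩ := hD
  obtain ⟨φ, hφ⟩ := Module.projective_lifting_property p ψ hp
  have hφ' : ∀ x, p (φ x) = ψ x := fun x => DFunLike.congr_fun hφ x
  let r : κ → LinearMap.ker p := fun i => ⟨φ (ρ i), by rw [LinearMap.mem_ker, hφ', hψ]⟩
  have hr : ∑ i, l i • r i = 0 := by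
    apply Subtype.ext
    have := congrArg φ hρ
    simpa [r] using this
  obtain ⟨s, hs⟩ := exists_sum_of_mem_span_smul_top l (hl.sub_mem r hr i j)
  have hs' : ∑ k, l k • (φ (g k) - s k) = 0 := by
    have h1 := congrArg Subtype.val hs
    have h2 := congrArg φ hg
    simp only [map_sub, map_sum, map_smul] at h2
    simp only [r, Submodule.coe_sub, Submodule.coe_sum, Submodule.coe_smul] at h1
    rw [h2] at h1
    simp only [smul_sub, Finset.sum_sub_distrib, h1, sub_self]
  have h3 := map_mem_smul_top p (hl.sub_mem _ hs' k k')
  have h4 : ∀ k, p (s k : P) = 0 := fun k => (s k).2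
  simpa [h4, hφ'] using h3

end ConstSyzygies

section Cycle

variable {ℓ n : ℕ} [NeZero n]

lemma ZMod.apply_eq_of_apply_add_one {α : Type} (g : ZMod n → α) (h : ∀ i, g (i + 1) = g i)
    (i j : ZMod n) : g i = g j := by
  have : ∀ k : ℕ, g k = g 0 := by
    intro k
    induction k with
    | zero => simp
    | succ k ih => rw [Nat.cast_succ, h, ih]
  rw [← ZMod.natCast_zmod_val i, ← ZMod.natCast_zmod_val j, this, this]

lemma ZMod.sum_sub_add_one {A : Type} [AddCommGroup A] (f : ZMod n → A) :
    ∑ i, (f i - f (i + 1)) = 0 := by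
  rw [Finset.sum_sub_distrib, sub_eq_zero]
  exact (Equiv.sum_comp (Equiv.addRight (1 : ZMod n)) f).symm

/-- The linear forms of consecutive vertices along the closed walk `c`. -/
noncomputable def cycleForm (c : ZMod n → Fin ℓ) (i : ZMod n) : Spoly ℓ := X (c i) - X (c (i + 1))

/-- The ideal generated by the differences of the variables along `c`. -/
noncomputable def cycleIdeal (c : ZMod n → Fin ℓ) : Ideal (Spoly ℓ) :=
  Ideal.span (Set.range (cycleForm c))

omit [NeZero n] in
lemma cycleForm_mem (c : ZMod n → Fin ℓ) (i : ZMod n) : cycleForm c i ∈ cycleIdeal c :=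
  Ideal.subset_span ⟨i, rfl⟩

lemma sub_mem_cycleIdeal_of_succ {c : ZMod n → Fin ℓ} {a : ZMod n → Spoly ℓ}
    (h : ∀ i, a (i + 1) - a i ∈ cycleIdeal c) (i j : ZMod n) : a i - a j ∈ cycleIdeal c :=
  Ideal.Quotient.eq.1 (ZMod.apply_eq_of_apply_add_one
    (fun i => Ideal.Quotient.mk (cycleIdeal c) (a i)) (fun i => Ideal.Quotient.eq.2 (h i)) i j)

lemma X_sub_X_mem_cycleIdeal (c : ZMod n → Fin ℓ) (i j : ZMod n) :
    (X (c i) - X (c j) : Spoly ℓ) ∈ cycleIdeal c :=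
  sub_mem_cycleIdeal_of_succ (a := fun i => X (c i)) (fun i => by
    rw [← neg_sub]
    exact neg_mem (cycleForm_mem c i)) i j

lemma hasConstSyzygies_cycleForm {c : ZMod n → Fin ℓ} (hc : Function.Injective c) :
    HasConstSyzygies (cycleForm c) := by
  intro a ha
  refine sub_mem_cycleIdeal_of_succ fun i => ?_
  have h1 := congrArg (pderiv (c (i + 1))) ha
  rw [map_sum, map_zero] at h1
  have h2 : ∀ j, pderiv (c (i + 1)) (cycleForm c j * a j) =
      cycleForm c j * pderiv (c (i + 1)) (a j) +
        ((if j = i + 1 then a j else 0) - if j = i then a j else 0) := by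
    intro j
    simp only [Derivation.leibniz, cycleForm, map_sub, pderiv_X, smul_eq_mul, Pi.single_apply,
      hc.eq_iff, add_left_inj]
    split_ifs <;> ring
  simp only [h2, Finset.sum_add_distrib, Finset.sum_sub_distrib, Finset.sum_ite_eq',
    Finset.mem_univ, if_true] at h1
  rw [eq_neg_of_add_eq_zero_right h1]
  exact neg_mem (Ideal.sum_mem _ fun j _ => Ideal.mul_mem_right _ _ (cycleForm_mem c j))

/-- The product of the differences of `x_v` with all variables outside of `c`. -/
noncomputable def outerProd (c : ZMod n → Fin ℓ) (v : Fin ℓ) : Spoly ℓ :=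
  ∏ j ∈ (Finset.univ.image c)ᶜ, (X v - X j)

lemma pderiv_outerProd {c : ZMod n → Fin ℓ} (hc : Function.Injective c) {v w : ZMod n}
    (hvw : v ≠ w) : pderiv (c v) (outerProd c (c w)) = 0 := by
  refine Finset.prod_induction _ (fun x => pderiv (c v) x = 0) (fun x y hx hy => ?_) ?_
    fun j hj => ?_
  · simp [Derivation.leibniz, hx, hy]
  · simp
  · have hjv : j ≠ c v := by
      rintro rfl
      simp at hj
    simp [pderiv_X, hc.eq_iff, hvw.symm, hjv]

lemma pderiv_mem_of_mem_mul_self {I : Ideal (Spoly ℓ)} {x : Spoly ℓ} (v : Fin ℓ) (hx : x ∈ I * I) :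
    pderiv v x ∈ I := by
  induction hx using Submodule.mul_induction_on' with
  | mem_mul_mem a ha b hb =>
    rw [Derivation.leibniz, smul_eq_mul, smul_eq_mul]
    exact add_mem (I.mul_mem_right _ ha) (I.mul_mem_right _ hb)
  | add x _ y _ hx hy =>
    rw [map_add]
    exact add_mem hx hy

lemma outerProd_mul_notMem {c : ZMod n → Fin ℓ} (hc : Function.Injective c) {u v w : ZMod n}
    (hvw : v ≠ w) (huv : u ≠ v) :
    outerProd c (c w) * (X (c u) - X (c v)) ∉ cycleIdeal c * cycleIdeal c := by
  intro h
  have h1 := pderiv_mem_of_mem_mul_self (c v) h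
  rw [Derivation.leibniz, pderiv_outerProd hc hvw, smul_zero, add_zero, map_sub, pderiv_X_self,
    pderiv_X_of_ne (hc.ne huv), zero_sub, smul_eq_mul, mul_neg, mul_one, neg_mem_iff] at h1
  let ev : Spoly ℓ →+* ℚ := (aeval fun j => if j ∈ Set.range c then (0 : ℚ) else 1).toRingHom
  have hev : ∀ j, ev (X j) = if j ∈ Set.range c then (0 : ℚ) else 1 := fun j => aeval_X _ j
  have h2 : cycleIdeal c ≤ RingHom.ker ev := by
    rw [cycleIdeal, Ideal.span_le]
    rintro _ ⟨i, rfl⟩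
    simp [cycleForm, RingHom.mem_ker, hev]
  have h3 := RingHom.mem_ker.1 (h2 h1)
  rw [outerProd, map_prod, Finset.prod_eq_zero_iff] at h3
  obtain ⟨j, hj, h4⟩ := h3
  simp only [Finset.mem_compl, Finset.mem_image, Finset.mem_univ, true_and] at hj
  simp [hev, hj] at h4

/-- Logarithmic vectors on the vertices of `c`. -/
noncomputable def cycleFun (G : SimpleGraph (Fin ℓ)) (c : ZMod n → Fin ℓ) :
    Submodule (Spoly ℓ) (ZMod n → Spoly ℓ) where
  carrier := {f | ∀ i j, G.Adj (c i) (c j) → (X (c i) - X (c j)) ∣ f i - f j}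
  add_mem' := fun {f g} hf hg i j h => by
    rw [Pi.add_apply, Pi.add_apply, add_sub_add_comm]
    exact dvd_add (hf i j h) (hg i j h)
  zero_mem' := fun i j _ => by simp
  smul_mem' := fun a f hf i j h => by
    rw [Pi.smul_apply, Pi.smul_apply, ← smul_sub]
    exact (hf i j h).mul_left a

/-- Extension of vectors on the vertices of `c` to all vertices. -/
noncomputable def extendFun (c : ZMod n → Fin ℓ) :
    (ZMod n → Spoly ℓ) →ₗ[Spoly ℓ] (Fin ℓ → Spoly ℓ) where
  toFun f v := outerProd c v * Function.extend c f 0 v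
  map_add' f g := by
    funext v
    have := congrFun (Function.extend_add c f g (0 : Fin ℓ → Spoly ℓ) 0) v
    rw [add_zero] at this
    rw [this, Pi.add_apply, Pi.add_apply, mul_add]
  map_smul' a f := by
    funext v
    have := congrFun (Function.extend_smul a c f (0 : Fin ℓ → Spoly ℓ)) v
    rw [smul_zero] at this
    rw [this, RingHom.id_apply, Pi.smul_apply, Pi.smul_apply, mul_smul_comm]

lemma extendFun_apply {c : ZMod n → Fin ℓ} (hc : Function.Injective c) (f : ZMod n → Spoly ℓ)
    (i : ZMod n) : extendFun c f (c i) = outerProd c (c i) * f i := by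
  change outerProd c (c i) * Function.extend c f 0 (c i) = _
  rw [hc.extend_apply]

lemma X_sub_X_dvd_outerProd {c : ZMod n → Fin ℓ} (u : Fin ℓ) {v : Fin ℓ} (hv : v ∉ Set.range c) :
    (X u - X v) ∣ outerProd c u :=
  Finset.dvd_prod_of_mem (fun j => (X u - X j : Spoly ℓ)) (by simpa using hv)

lemma extendFun_mem {G : SimpleGraph (Fin ℓ)} {c : ZMod n → Fin ℓ} (hc : Function.Injective c)
    {f : ZMod n → Spoly ℓ} (hf : f ∈ cycleFun G c) : extendFun c f ∈ logFun G := by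
  have h0 : ∀ v ∉ Set.range c, extendFun c f v = 0 := fun v hv => by
    have : Function.extend c f (0 : Fin ℓ → Spoly ℓ) v = 0 :=
      Function.extend_apply' (f := c) f (0 : Fin ℓ → Spoly ℓ) v hv
    change outerProd c v * Function.extend c f 0 v = 0
    rw [this, mul_zero]
  intro u v huv
  by_cases hu : u ∈ Set.range c <;> by_cases hv : v ∈ Set.range c
  · obtain ⟨i, rfl⟩ := hu
    obtain ⟨j, rfl⟩ := hv
    rw [extendFun_apply hc, extendFun_apply hc]
    have : outerProd c (c i) * f i - outerProd c (c j) * f j =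
      outerProd c (c i) * (f i - f j) + (outerProd c (c i) - outerProd c (c j)) * f j := by ring
    rw [this]
    exact dvd_add ((hf i j huv).mul_left _) ((sub_dvd_prod_sub_prod _ _ _).mul_right _)
  · rw [h0 v hv, sub_zero]
    exact (X_sub_X_dvd_outerProd u hv).mul_right _
  · rw [h0 u hu, zero_sub, ← neg_sub, neg_dvd, dvd_neg]
    exact (X_sub_X_dvd_outerProd v hu).mul_right _
  · simp [h0 u hu, h0 v hv]

/-- Extension of logarithmic vectors from the vertices of `c` to all vertices. -/
noncomputable def cycleFunExtend (G : SimpleGraph (Fin ℓ)) {c : ZMod n → Fin ℓ}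
    (hc : Function.Injective c) : cycleFun G c →ₗ[Spoly ℓ] logFun G :=
  (extendFun c).restrict fun _ hf => extendFun_mem hc hf

/-- A semilinear form on `D` with values in `π I` maps `I D` to `π I²`. -/
lemma exists_mem_mul_self_of_mem_smul_top {R D : Type} [CommRing R] [AddCommGroup D] [Module R D]
    {I : Ideal R} (σ : R →+* R) (hσ : ∀ x ∈ I, σ x ∈ I) (Λ : D →+ R)
    (hΛ : ∀ a f, Λ (a • f) = σ a * Λ f) (π : R) (hI : ∀ f, ∃ x ∈ I, Λ f = π * x) {f : D}
    (hf : f ∈ I • (⊤ : Submodule R D)) : ∃ x ∈ I * I, Λ f = π * x := by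
  induction hf using Submodule.smul_induction_on' with
  | smul r hr g _ =>
    obtain ⟨x, hx, h⟩ := hI g
    exact ⟨σ r * x, Ideal.mul_mem_mul (hσ r hr) hx, by rw [hΛ, h, mul_left_comm]⟩
  | add f _ g _ hf hg =>
    obtain ⟨x, hx, h⟩ := hf
    obtain ⟨y, hy, h'⟩ := hg
    exact ⟨x + y, add_mem hx hy, by rw [map_add, h, h', mul_add]⟩

lemma sum_smul_pi_single {R M κ : Type} [CommRing R] [AddCommGroup M] [Module R M] [Fintype κ]
    [DecidableEq κ] (l : κ → R) (a : κ) (x : M) :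
    ∑ i, l i • (Pi.single a x : κ → M) i = l a • x := by
  simp [Pi.single_apply]

omit [NeZero n] in
lemma ZMod.natCast_ne_of_lt {a b : ℕ} (ha : a < n) (hb : b < n) (hab : a ≠ b) :
    (a : ZMod n) ≠ b := fun h => hab (by
  have := congrArg ZMod.val h
  rwa [ZMod.val_natCast_of_lt ha, ZMod.val_natCast_of_lt hb] at this)

/-- The indicator function of the arc from `1` to `j`. -/
def arcFun (R : Type) [CommRing R] (j : ZMod n) : ZMod n → R :=
  ∑ k ∈ Finset.range j.val, Pi.single ((k : ZMod n) + 1) 1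

lemma arcFun_sub_add_one (R : Type) [CommRing R] (j v : ZMod n) :
    arcFun R j v - arcFun R j (v + 1) =
      (Pi.single j 1 : ZMod n → R) v - (Pi.single 0 1 : ZMod n → R) v := by
  have := Finset.sum_range_sub (fun k : ℕ => (Pi.single (k : ZMod n) 1 : ZMod n → R) v) j.val
  rw [ZMod.natCast_zmod_val, Nat.cast_zero] at this
  rw [← this, arcFun, Finset.sum_apply, Finset.sum_apply, ← Finset.sum_sub_distrib]
  refine Finset.sum_congr rfl fun k _ => ?_
  simp only [Pi.single_apply, add_left_inj, Nat.cast_add, Nat.cast_one]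

/-- Koszul-type logarithmic vectors on an induced cycle. -/
noncomputable def koszulFun (c : ZMod n → Fin ℓ) (i j : ZMod n) : ZMod n → Spoly ℓ :=
  (cycleForm c i * cycleForm c j) • (arcFun _ j - arcFun _ i)

lemma koszulFun_mem {G : SimpleGraph (Fin ℓ)} {c : ZMod n → Fin ℓ}
    (hG : ∀ i j, G.Adj (c i) (c j) ↔ j = i + 1 ∨ i = j + 1) (i j : ZMod n) :
    koszulFun c i j ∈ cycleFun G c := by
  have key : ∀ v, (X (c v) - X (c (v + 1)) : Spoly ℓ) ∣
      koszulFun c i j v - koszulFun c i j (v + 1) := fun v => by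
    have : koszulFun c i j v - koszulFun c i j (v + 1) = cycleForm c i * cycleForm c j *
        ((Pi.single j 1 : ZMod n → Spoly ℓ) v - (Pi.single i 1 : ZMod n → Spoly ℓ) v) := by
      have hi := arcFun_sub_add_one (Spoly ℓ) i v
      have hj := arcFun_sub_add_one (Spoly ℓ) j v
      simp only [koszulFun, Pi.smul_apply, Pi.sub_apply, smul_eq_mul]
      linear_combination cycleForm c i * cycleForm c j * (hj - hi)
    rw [this, mul_sub]
    refine dvd_sub ?_ ?_
    · by_cases h : v = j
      · subst h
        exact (dvd_mul_left _ _).mul_right _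
      · simp [h]
    · by_cases h : v = i
      · subst h
        exact (dvd_mul_right _ _).mul_right _
      · simp [h]
  intro v w hvw
  rcases (hG v w).1 hvw with rfl | rfl
  · exact key v
  · rw [← neg_sub, ← neg_sub (koszulFun c i j w), neg_dvd, dvd_neg]
    exact key w

omit [NeZero n] in
lemma koszulFun_one_two (hn : 5 ≤ n) (c : ZMod n → Fin ℓ) :
    koszulFun c 1 2 = Pi.single 2 (cycleForm c 1 * cycleForm c 2) := by
  have h1 : (1 : ZMod n).val = 1 := by
    simpa using ZMod.val_natCast_of_lt (show 1 < n by omega)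
  have h2 : (2 : ZMod n).val = 2 := by
    simpa using ZMod.val_natCast_of_lt (show 2 < n by omega)
  have h3 : arcFun (Spoly ℓ) (2 : ZMod n) - arcFun _ 1 = Pi.single 2 1 := by
    rw [arcFun, arcFun, h1, h2, Finset.sum_range_succ, add_sub_cancel_left, Nat.cast_one,
      one_add_one_eq_two]
  rw [koszulFun, h3, ← Pi.single_smul', smul_eq_mul, mul_one]

/-- An induced cycle of length at least five obstructs a short resolution. -/
lemma not_hasShortResolution_of_inducedCycle (hn : 5 ≤ n) {G : SimpleGraph (Fin ℓ)}
    {c : ZMod n → Fin ℓ} (hc : Function.Injective c)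
    (hG : ∀ i j, G.Adj (c i) (c j) ↔ j = i + 1 ∨ i = j + 1) :
    ¬ HasShortResolution (R := Spoly ℓ) (logFun G) := by
  intro hD
  have hne : ∀ a b : ℕ, a < 5 → b < 5 → a ≠ b → (a : ZMod n) ≠ b := fun a b ha hb =>
    ZMod.natCast_ne_of_lt (by omega) (by omega)
  have h01 : (0 : ZMod n) ≠ 1 := by exact_mod_cast hne 0 1 (by decide) (by decide) (by decide)
  have h02 : (0 : ZMod n) ≠ 2 := by exact_mod_cast hne 0 2 (by decide) (by decide) (by decide)
  have h03 : (0 : ZMod n) ≠ 3 := by exact_mod_cast hne 0 3 (by decide) (by decide) (by decide)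
  have h04 : (0 : ZMod n) ≠ 4 := by exact_mod_cast hne 0 4 (by decide) (by decide) (by decide)
  have h12 : (1 : ZMod n) ≠ 2 := by exact_mod_cast hne 1 2 (by decide) (by decide) (by decide)
  have h13 : (1 : ZMod n) ≠ 3 := by exact_mod_cast hne 1 3 (by decide) (by decide) (by decide)
  have h14 : (1 : ZMod n) ≠ 4 := by exact_mod_cast hne 1 4 (by decide) (by decide) (by decide)
  have h23 : (2 : ZMod n) ≠ 3 := by exact_mod_cast hne 2 3 (by decide) (by decide) (by decide)
  have h24 : (2 : ZMod n) ≠ 4 := by exact_mod_cast hne 2 4 (by decide) (by decide) (by decide)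
  have h34 : (3 : ZMod n) ≠ 4 := by exact_mod_cast hne 3 4 (by decide) (by decide) (by decide)
  have e12 : (1 + 1 : ZMod n) = 2 := by norm_num
  have e23 : (2 + 1 : ZMod n) = 3 := by norm_num
  let l := cycleForm c
  let b : ZMod n → ZMod n → logFun G := fun i j =>
    cycleFunExtend G hc ⟨koszulFun c i j, koszulFun_mem hG i j⟩
  let e : ZMod n → ZMod n → (ZMod n × ZMod n → Spoly ℓ) := fun i j => Pi.single (i, j) 1
  let ψ : (ZMod n × ZMod n → Spoly ℓ) →ₗ[Spoly ℓ] logFun G :=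
    Fintype.linearCombination (Spoly ℓ) fun ij => b ij.1 ij.2
  have hψ : ∀ i j, ψ (e i j) = b i j := fun i j => by
    simp [ψ, e, Fintype.linearCombination_apply_single]
  let r : ZMod n → ZMod n → ZMod n → (ZMod n × ZMod n → Spoly ℓ) := fun i j k =>
    l i • e j k - l j • e i k + l k • e i j
  have hr : ∀ i j k, ψ (r i j k) = 0 := fun i j k => by
    simp only [r, map_add, map_sub, map_smul, hψ, b]
    rw [← map_smul, ← map_smul, ← map_smul, ← map_sub, ← map_add]
    convert map_zero (cycleFunExtend G hc)
    apply Subtype.ext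
    funext v
    simp only [l, koszulFun, Submodule.coe_add, Submodule.coe_sub, Submodule.coe_smul,
      Pi.add_apply, Pi.sub_apply, Pi.smul_apply, smul_eq_mul, Submodule.coe_zero, Pi.zero_apply]
    ring
  let ρ : ZMod n → (ZMod n × ZMod n → Spoly ℓ) :=
    Pi.single 0 (r 1 2 3) - Pi.single 1 (r 0 2 3) + Pi.single 2 (r 0 1 3) - Pi.single 3 (r 0 1 2)
  let g : ZMod n → (ZMod n × ZMod n → Spoly ℓ) :=
    Pi.single 1 (e 2 3) - Pi.single 2 (e 1 3) + Pi.single 3 (e 1 2)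
  have hmem := HasShortResolution.sub_mem (hasConstSyzygies_cycleForm hc) hD ψ ρ
    (fun i => by
      have : ∀ a (x : ZMod n × ZMod n → Spoly ℓ), ψ x = 0 →
          ψ ((Pi.single a x : ZMod n → _) i) = 0 := fun a x hx => by
        by_cases h : i = a
        · subst h; simpa using hx
        · simp [h]
      simp only [ρ, Pi.add_apply, Pi.sub_apply, map_add, map_sub, this _ _ (hr _ _ _), sub_self,
        add_zero])
    (by
      simp only [ρ, Pi.add_apply, Pi.sub_apply, smul_add, smul_sub, Finset.sum_add_distrib,
        Finset.sum_sub_distrib, sum_smul_pi_single]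
      simp only [r, l]
      module) (i := 0) (j := 4) g
    (by
      have h0 : ρ 0 = r 1 2 3 := by simp [ρ, h01, h02, h03]
      have h4 : ρ 4 = 0 := by
        simp [ρ, h04.symm, h14.symm, h24.symm, h34.symm]
      simp only [h0, h4, sub_zero, g, Pi.add_apply, Pi.sub_apply, smul_add, smul_sub,
        Finset.sum_add_distrib, Finset.sum_sub_distrib, sum_smul_pi_single]
      rfl) 3 0
  have hg3 : g 3 = e 1 2 := by simp [g, h13.symm, h23.symm]
  have hg0 : g 0 = 0 := by simp [g, h01, h02, h03]
  rw [hg3, hg0, map_zero, sub_zero, hψ] at hmem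
  let Λ : logFun G →+ Spoly ℓ := AddMonoidHom.mk'
    (fun f => l 2 * (f.1 (c 1) - f.1 (c 2)) - l 1 * (f.1 (c 2) - f.1 (c 3))) fun f f' => by
      simp only [Submodule.coe_add, Pi.add_apply]
      ring
  obtain ⟨x, hx, hΛ⟩ := exists_mem_mul_self_of_mem_smul_top (I := cycleIdeal c) (RingHom.id _)
    (fun x hx => hx) Λ (fun a f => by
      simp only [Λ, AddMonoidHom.mk'_apply, Submodule.coe_smul, Pi.smul_apply, smul_eq_mul,
        RingHom.id_apply]
      ring) (l 1 * l 2)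
    (fun f => by
      choose a ha using fun i => f.2 _ _ ((hG i (i + 1)).2 (Or.inl rfl))
      refine ⟨a 1 - a 2, hasConstSyzygies_cycleForm hc a ?_ 1 2, ?_⟩
      · rw [← ZMod.sum_sub_add_one fun i => f.1 (c i)]
        exact Finset.sum_congr rfl fun i _ => (ha i).symm
      · have h1 := ha 1
        have h2 := ha 2
        rw [e12] at h1
        rw [e23] at h2
        simp only [Λ, AddMonoidHom.mk'_apply, h1, h2, l, cycleForm, e12, e23]
        ring) hmem
  have hb : Λ (b 1 2) = l 1 * l 2 * -(outerProd c (c 2) * (X (c 1) - X (c 3))) := by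
    have : ∀ i, (b 1 2).1 (c i) = outerProd c (c i) *
        (Pi.single 2 (cycleForm c 1 * cycleForm c 2) : ZMod n → Spoly ℓ) i := fun i => by
      rw [← koszulFun_one_two hn]
      exact extendFun_apply hc _ i
    simp only [Λ, AddMonoidHom.mk'_apply, this, Pi.single_apply, h12, h23.symm, if_true, if_false,
      l, cycleForm, e12, e23]
    ring
  rw [hb] at hΛ
  have hl : l 1 * l 2 ≠ 0 := by
    refine mul_ne_zero (X_sub_X_ne_zero (hc.ne ?_)) (X_sub_X_ne_zero (hc.ne ?_))
    · rwa [e12]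
    · rwa [e23]
  refine outerProd_mul_notMem hc (w := 2) (u := 1) (v := 3) h23.symm h13 ?_
  rw [← neg_mem_iff, mul_left_cancel₀ hl hΛ]
  exact hx

lemma prod_compl_eq_mul {κ M : Type} [Fintype κ] [DecidableEq κ] [CommMonoid M] {s : Finset κ}
    {a : κ} (ha : a ∉ s) (f : κ → M) : ∏ j ∈ sᶜ, f j = f a * ∏ j ∈ (insert a s)ᶜ, f j := by
  rw [Finset.compl_insert, Finset.mul_prod_erase _ _ (Finset.mem_compl.2 ha)]

lemma subst_prod_X_sub_X {κ : Type} {a b v : Fin ℓ} (hv : v ≠ b) (s : Finset κ) (d : κ → Fin ℓ)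
    (hs : ∀ w ∈ s, d w ≠ b) :
    subst a b (∏ w ∈ s, (X v - X (d w))) = ∏ w ∈ s, (X v - X (d w)) := by
  rw [map_prod]
  exact Finset.prod_congr rfl fun w hw => by
    rw [map_sub, subst_X_of_ne hv, subst_X_of_ne (hs w hw)]

/-- The monic polynomial whose roots are the variables along `c` outside of `s`. -/
noncomputable def complPoly (c : ZMod n → Fin ℓ) (s : Finset (ZMod n)) : Polynomial (Spoly ℓ) :=
  ∏ j ∈ sᶜ, (Polynomial.X - Polynomial.C (X (c j)))

lemma complPoly_eq_mul (c : ZMod n → Fin ℓ) {s : Finset (ZMod n)} {a : ZMod n} (ha : a ∉ s) :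
    complPoly c s = (Polynomial.X - Polynomial.C (X (c a))) * complPoly c (insert a s) :=
  prod_compl_eq_mul ha _

lemma complPoly_sub (c : ZMod n → Fin ℓ) {s : Finset (ZMod n)} {a b : ZMod n} (ha : a ∉ s)
    (hb : b ∉ s) (hab : a ≠ b) : complPoly c (insert a s) - complPoly c (insert b s) =
      (X (c a) - X (c b) : Spoly ℓ) • complPoly c (insert b (insert a s)) := by
  rw [complPoly_eq_mul c (s := insert a s) (a := b) (by simp [hb, hab.symm]),
    complPoly_eq_mul c (s := insert b s) (a := a) (by simp [ha, hab]), Finset.insert_comm a b,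
    Polynomial.smul_eq_C_mul, map_sub]
  ring

lemma eval_complPoly (c : ZMod n → Fin ℓ) (s : Finset (ZMod n)) (x : Spoly ℓ) :
    (complPoly c s).eval x = ∏ j ∈ sᶜ, (x - X (c j)) := by
  simp [complPoly, Polynomial.eval_prod]

lemma eval_complPoly_eq_zero (c : ZMod n → Fin ℓ) {s : Finset (ZMod n)} {v : ZMod n}
    (hv : v ∉ s) : (complPoly c s).eval (X (c v)) = 0 := by
  rw [complPoly_eq_mul c hv]
  simp

/-- The product of the differences of `x_v` with the variables not adjacent to `v` on `c`. -/
noncomputable def farProd (c : ZMod n → Fin ℓ) (v : ZMod n) : Spoly ℓ :=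
  (complPoly c {v - 1, v, v + 1}).eval (X (c v))

lemma X_sub_X_dvd_farProd (c : ZMod n → Fin ℓ) {v w : ZMod n} (h : w ≠ v) (h1 : w ≠ v + 1)
    (h2 : v ≠ w + 1) : (X (c v) - X (c w)) ∣ farProd c v := by
  rw [farProd, eval_complPoly]
  refine Finset.dvd_prod_of_mem (fun j => (X (c v) - X (c j) : Spoly ℓ)) ?_
  have h3 : w ≠ v - 1 := fun h => h2 (by rw [h, sub_add_cancel])
  simp [h, h1, h3]

/-- Logarithmic vectors on an induced antihole. -/
noncomputable def antiholeMap (c : ZMod n → Fin ℓ) :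
    (Polynomial (Spoly ℓ) × (ZMod n → Spoly ℓ)) →ₗ[Spoly ℓ] (ZMod n → Spoly ℓ) where
  toFun q v := q.1.eval (X (c v)) + q.2 v * farProd c v
  map_add' p q := by
    funext v
    simp only [Prod.fst_add, Prod.snd_add, Polynomial.eval_add, Pi.add_apply]
    ring
  map_smul' a q := by
    funext v
    simp only [Prod.smul_fst, Prod.smul_snd, Polynomial.eval_smul, Pi.smul_apply, smul_eq_mul,
      RingHom.id_apply]
    ring

lemma antiholeMap_apply (c : ZMod n → Fin ℓ) (q : Polynomial (Spoly ℓ) × (ZMod n → Spoly ℓ))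
    (v : ZMod n) : antiholeMap c q v = q.1.eval (X (c v)) + q.2 v * farProd c v := rfl

lemma antiholeMap_mem {G : SimpleGraph (Fin ℓ)} {c : ZMod n → Fin ℓ}
    (hG : ∀ i j, G.Adj (c i) (c j) ↔ i ≠ j ∧ j ≠ i + 1 ∧ i ≠ j + 1)
    (q : Polynomial (Spoly ℓ) × (ZMod n → Spoly ℓ)) : antiholeMap c q ∈ cycleFun G c := by
  intro i j hij
  obtain ⟨h, h1, h2⟩ := (hG i j).1 hij
  have : antiholeMap c q i - antiholeMap c q j = (q.1.eval (X (c i)) - q.1.eval (X (c j))) +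
      (q.2 i * farProd c i - q.2 j * farProd c j) := by
    simp only [antiholeMap_apply]
    ring
  rw [this]
  refine dvd_add (Polynomial.sub_dvd_eval_sub _ _ _) (dvd_sub ?_ ?_)
  · exact (X_sub_X_dvd_farProd c h.symm h1 h2).mul_left _
  · rw [← neg_sub, neg_dvd]
    exact (X_sub_X_dvd_farProd c h h2 h1).mul_left _

/-- The basic relations between logarithmic vectors on an induced antihole. -/
noncomputable def antiholeRel (c : ZMod n → Fin ℓ) (i : ZMod n) :
    Polynomial (Spoly ℓ) × (ZMod n → Spoly ℓ) :=
  (complPoly c {i, i + 1}, cycleForm c (i - 1) • Pi.single i 1 -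
    cycleForm c (i + 1) • Pi.single (i + 1) 1)

lemma antiholeMap_antiholeRel (c : ZMod n → Fin ℓ) (h1 : (0 : ZMod n) ≠ 1) (h2 : (0 : ZMod n) ≠ 2)
    (i : ZMod n) : antiholeMap c (antiholeRel c i) = 0 := by
  have hi : i ≠ i + 1 := fun h => h1 (by linear_combination h)
  funext v
  simp only [antiholeMap_apply, antiholeRel, Pi.sub_apply, Pi.smul_apply, smul_eq_mul,
    Pi.zero_apply]
  by_cases hvi : v = i
  · subst hvi
    have h : v - 1 ∉ ({v, v + 1} : Finset (ZMod n)) := by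
      simp only [Finset.mem_insert, Finset.mem_singleton, not_or]
      exact ⟨fun h => h1 (by linear_combination h), fun h => h2 (by linear_combination h)⟩
    rw [complPoly_eq_mul c h, Polynomial.eval_mul, ← farProd]
    simp [hi, cycleForm]
    ring
  by_cases hvi' : v = i + 1
  · subst hvi'
    have h : i + 1 + 1 ∉ ({i, i + 1} : Finset (ZMod n)) := by
      simp only [Finset.mem_insert, Finset.mem_singleton, not_or]
      exact ⟨fun h => h2 (by linear_combination -h), fun h => h1 (by linear_combination -h)⟩
    have hs : insert (i + 1 + 1) ({i, i + 1} : Finset (ZMod n)) =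
        {i + 1 - 1, i + 1, i + 1 + 1} := by
      ext x
      simp only [Finset.mem_insert, Finset.mem_singleton, add_sub_cancel_right]
      tauto
    rw [complPoly_eq_mul c h, Polynomial.eval_mul, hs, ← farProd]
    simp [hi.symm, cycleForm]
    ring
  · rw [eval_complPoly_eq_zero c (by simp [hvi, hvi'])]
    simp [hvi, hvi']

lemma sum_smul_antiholeRel (c : ZMod n → Fin ℓ) (h1 : (0 : ZMod n) ≠ 1) :
    ∑ i, cycleForm c i • antiholeRel c i = 0 := by
  rw [← ZMod.sum_sub_add_one fun i => ((complPoly c {i},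
    (cycleForm c i * cycleForm c (i - 1)) • Pi.single i 1) :
      Polynomial (Spoly ℓ) × (ZMod n → Spoly ℓ))]
  refine Finset.sum_congr rfl fun i _ => ?_
  have hi : i ≠ i + 1 := fun h => h1 (by linear_combination h)
  refine Prod.ext ?_ ?_
  · have := complPoly_sub c (s := ∅) (Finset.notMem_empty i) (Finset.notMem_empty (i + 1)) hi
    rw [Finset.insert_comm] at this
    exact this.symm
  · simp only [antiholeRel, Prod.smul_snd, Prod.snd_sub, add_sub_cancel_right]
    module

/-- An induced antihole with at least five vertices obstructs a short resolution. -/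
lemma not_hasShortResolution_of_inducedAntihole (hn : 5 ≤ n) {G : SimpleGraph (Fin ℓ)}
    {c : ZMod n → Fin ℓ} (hc : Function.Injective c)
    (hG : ∀ i j, G.Adj (c i) (c j) ↔ i ≠ j ∧ j ≠ i + 1 ∧ i ≠ j + 1) :
    ¬ HasShortResolution (R := Spoly ℓ) (logFun G) := by
  intro hD
  have hne : ∀ a b : ℕ, a < 5 → b < 5 → a ≠ b → (a : ZMod n) ≠ b := fun a b ha hb =>
    ZMod.natCast_ne_of_lt (by omega) (by omega)
  have h01 : (0 : ZMod n) ≠ 1 := by exact_mod_cast hne 0 1 (by decide) (by decide) (by decide)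
  have h02 : (0 : ZMod n) ≠ 2 := by exact_mod_cast hne 0 2 (by decide) (by decide) (by decide)
  have h03 : (0 : ZMod n) ≠ 3 := by exact_mod_cast hne 0 3 (by decide) (by decide) (by decide)
  have h04 : (0 : ZMod n) ≠ 4 := by exact_mod_cast hne 0 4 (by decide) (by decide) (by decide)
  have h12 : (1 : ZMod n) ≠ 2 := by exact_mod_cast hne 1 2 (by decide) (by decide) (by decide)
  have h13 : (1 : ZMod n) ≠ 3 := by exact_mod_cast hne 1 3 (by decide) (by decide) (by decide)
  have h14 : (1 : ZMod n) ≠ 4 := by exact_mod_cast hne 1 4 (by decide) (by decide) (by decide)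
  have h23 : (2 : ZMod n) ≠ 3 := by exact_mod_cast hne 2 3 (by decide) (by decide) (by decide)
  have h24 : (2 : ZMod n) ≠ 4 := by exact_mod_cast hne 2 4 (by decide) (by decide) (by decide)
  have h34 : (3 : ZMod n) ≠ 4 := by exact_mod_cast hne 3 4 (by decide) (by decide) (by decide)
  have e01 : (0 + 1 : ZMod n) = 1 := by norm_num
  have e12 : (1 + 1 : ZMod n) = 2 := by norm_num
  have e23 : (2 + 1 : ZMod n) = 3 := by norm_num
  have e34 : (3 + 1 : ZMod n) = 4 := by norm_num
  have e10 : (1 - 1 : ZMod n) = 0 := by norm_num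
  have e21 : (2 - 1 : ZMod n) = 1 := by norm_num
  let ψ : (Polynomial (Spoly ℓ) × (ZMod n → Spoly ℓ)) →ₗ[Spoly ℓ] logFun G :=
    (cycleFunExtend G hc).comp ((antiholeMap c).codRestrict _ (antiholeMap_mem hG))
  let s : ZMod n → (ZMod n → Spoly ℓ) := fun i => Pi.single i 1
  let u := complPoly c {1, 2, 3}
  let a : ZMod n → Polynomial (Spoly ℓ) × (ZMod n → Spoly ℓ) := fun i => (0, s i)
  let b : Polynomial (Spoly ℓ) × (ZMod n → Spoly ℓ) := (u, -s 2)
  let g : ZMod n → Polynomial (Spoly ℓ) × (ZMod n → Spoly ℓ) :=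
    Pi.single 0 (a 1) + Pi.single 1 b + Pi.single 2 b + Pi.single 3 (a 3)
  have hmem := HasShortResolution.sub_mem (hasConstSyzygies_cycleForm hc) hD ψ (antiholeRel c)
    (fun i => by
      have : (antiholeMap c).codRestrict _ (antiholeMap_mem hG) (antiholeRel c i) = 0 :=
        Subtype.ext (antiholeMap_antiholeRel c h01 h02 i)
      rw [LinearMap.comp_apply, this, map_zero])
    (sum_smul_antiholeRel c h01) (i := 1) (j := 2) g
    (by
      simp only [g, Pi.add_apply, smul_add, Finset.sum_add_distrib, sum_smul_pi_single]
      refine Prod.ext ?_ ?_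
      · have := complPoly_sub c (s := {2}) (a := 1) (b := 3) (by simpa using h12)
          (by simpa using h23.symm) h13
        rw [Finset.pair_comm 3 2, Finset.insert_comm 3, Finset.pair_comm 3 2] at this
        simp only [antiholeRel, Prod.fst_sub, Prod.fst_add, Prod.smul_fst, e12, e23, this, u, a, b,
          cycleForm]
        module
      · simp only [antiholeRel, Prod.snd_sub, Prod.snd_add, Prod.smul_snd, e12, e23, e10, e21, s, a, b]
        module) 0 4
  have hg0 : g 0 = a 1 := by simp [g, h01, h02, h03]
  have hg4 : g 4 = 0 := by simp [g, h04.symm, h14.symm, h24.symm, h34.symm]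
  rw [hg0, hg4, map_zero, sub_zero] at hmem
  have hX : ∀ {x : Spoly ℓ} (i j : ZMod n), (X (c i) - X (c j)) ∣ x → x ∈ cycleIdeal c :=
    fun i j h => Ideal.mem_of_dvd _ h (X_sub_X_mem_cycleIdeal c i j)
  let Λ : logFun G →+ Spoly ℓ := AddMonoidHom.mk'
    (fun f => subst (c 1) (c 2) (f.1 (c 1) - f.1 (c 2))) fun f f' => by
      rw [← map_add]
      simp only [Submodule.coe_add, Pi.add_apply, add_sub_add_comm]
  let N : Finset (ZMod n) := {3, 0, 1, 2}ᶜ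
  let p : Spoly ℓ := ∏ w ∈ N, (X (c 1) - X (c w))
  have hN : ∀ {w}, w ∈ N ↔ w ≠ 3 ∧ w ≠ 0 ∧ w ≠ 1 ∧ w ≠ 2 := by simp [N]
  have hp : p ≠ 0 := Finset.prod_ne_zero_iff.2 fun w hw =>
    X_sub_X_ne_zero (hc.ne (hN.1 hw).2.2.1.symm)
  obtain ⟨x, hx, hΛ⟩ := exists_mem_mul_self_of_mem_smul_top (I := cycleIdeal c)
    (subst (c 1) (c 2)).toRingHom
    (fun x hx => by
      have := sub_mem hx (hX 1 2 (dvd_sub_subst (c 1) (c 2) x))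
      rwa [sub_sub_cancel] at this) Λ
    (fun a f => by
      simp only [Λ, AddMonoidHom.mk'_apply, Submodule.coe_smul, Pi.smul_apply, smul_eq_mul,
        ← mul_sub, map_mul]
      rfl) p
    (fun f => by
      have hdvd : p ∣ Λ f := by
        have := prod_dvd_subst_sub f.2 (a := c 1) (b := c 2) (N := N.image c) (by
          intro v hv
          obtain ⟨w, hw, rfl⟩ := Finset.mem_image.1 hv
          obtain ⟨hw3, hw0, hw1, hw2⟩ := hN.1 hw
          refine ⟨(hG _ _).2 ⟨hw1.symm, by rwa [e12], fun h => hw0 ?_⟩,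
            (hG _ _).2 ⟨hw2.symm, by rwa [e23], fun h => hw1 ?_⟩⟩
          · linear_combination -h
          · linear_combination e12 - h)
        rwa [Finset.prod_image hc.injOn] at this
      obtain ⟨y, hy⟩ := hdvd
      refine ⟨y, ?_, hy⟩
      obtain ⟨A, hA⟩ := f.2 (c 1) (c 3) ((hG _ _).2 ⟨h13, by rw [e12]; exact h23.symm,
        by rwa [e34]⟩)
      obtain ⟨B, hB⟩ := f.2 (c 3) (c 0) ((hG _ _).2 ⟨h03.symm, by rwa [e34],
        by rw [e01]; exact h13.symm⟩)
      obtain ⟨C, hC⟩ := f.2 (c 0) (c 2) ((hG _ _).2 ⟨h02, by rw [e01]; exact h12.symm,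
        by rwa [e23]⟩)
      have hf : f.1 (c 1) - f.1 (c 2) = (X (c 1) - X (c 3)) * A + (X (c 3) - X (c 0)) * B +
          (X (c 0) - X (c 2)) * C := by
        rw [← hA, ← hB, ← hC]
        ring
      have h1 : subst (c 1) (c 0) (subst (c 1) (c 3) (Λ f)) = 0 := by
        change subst _ _ (subst _ _ (subst _ _ (f.1 (c 1) - f.1 (c 2)))) = 0
        rw [hf]
        simp only [map_add, map_sub, map_mul, subst_X_left,
          subst_X_self, subst_X_of_ne (hc.ne h23.symm), subst_X_of_ne (hc.ne h02),
          subst_X_of_ne (hc.ne h03)]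
        ring
      rw [hy, map_mul, map_mul, subst_prod_X_sub_X (hc.ne h13) _ _ fun w hw => hc.ne (hN.1 hw).1,
        subst_prod_X_sub_X (hc.ne h01.symm) _ _ fun w hw => hc.ne (hN.1 hw).2.1] at h1
      have h2 := (mul_eq_zero.1 h1).resolve_left hp
      have h3 := add_mem (hX 1 3 (dvd_sub_subst (c 1) (c 3) y))
        (hX 1 0 (dvd_sub_subst (c 1) (c 0) (subst (c 1) (c 3) y)))
      rwa [h2, sub_zero, sub_add_cancel] at h3) hmem
  have hval : ∀ i, (ψ (a 1)).1 (c i) =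
      outerProd c (c i) * ((Pi.single 1 1 : ZMod n → Spoly ℓ) i * farProd c i) := fun i => by
    refine (extendFun_apply hc _ i).trans ?_
    change outerProd c (c i) * antiholeMap c (a 1) i = _
    rw [antiholeMap_apply]
    simp only [a, s, Polynomial.eval_zero, zero_add]
  have hfar : farProd c 1 = (X (c 1) - X (c 3)) * p := by
    rw [farProd, eval_complPoly, e10, e12, prod_compl_eq_mul (a := 3)
      (by simp [h03.symm, h13.symm, h23.symm])]
  have hb : Λ (ψ (a 1)) = p * (outerProd c (c 1) * (X (c 1) - X (c 3))) := by
    change subst _ _ (_ - _) = _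
    rw [hval, hval, Pi.single_eq_same, Pi.single_eq_of_ne h12.symm, hfar, one_mul, zero_mul,
      mul_zero, sub_zero]
    simp only [map_mul, map_sub, subst_X_left, subst_X_of_ne (hc.ne h23.symm)]
    rw [subst_prod_X_sub_X (hc.ne h12) _ _ fun w hw => hc.ne (hN.1 hw).2.2.2, outerProd,
      subst_prod_X_sub_X (hc.ne h12) _ _ fun w hw => by
        rintro rfl
        simp at hw]
    ring
  rw [hb] at hΛ
  refine outerProd_mul_notMem hc (w := 1) (u := 1) (v := 3) h13.symm h13 ?_
  rw [mul_left_cancel₀ hp hΛ]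
  exact hx

end Cycle

lemma weaklyChordal_of_hasShortResolution {ℓ : ℕ} {G : SimpleGraph (Fin ℓ)}
    (hD : HasShortResolution (R := Spoly ℓ) (logFun G)) : WeaklyChordal G := by
  refine ⟨fun n hn h => ?_, fun n hn h => ?_⟩
  all_goals
    obtain ⟨m, rfl⟩ := Nat.exists_eq_add_of_le' hn
    obtain ⟨f⟩ := hasInducedCycleLen_iff.1 h
    have hadj : ∀ i j : ZMod (m + 5), (SimpleGraph.cycleGraph (m + 5)).Adj i j ↔
        j = i + 1 ∨ i = j + 1 := fun i j => by
      have := SimpleGraph.cycleGraph_adj (n := m + 3) (u := i) (v := j)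
      rw [this, or_comm]
      exact or_congr (sub_eq_iff_eq_add' (G := ZMod (m + 5)))
        (sub_eq_iff_eq_add' (G := ZMod (m + 5)))
  · exact not_hasShortResolution_of_inducedCycle hn (c := fun i : ZMod (m + 5) => f i)
      f.injective (fun i j => f.map_adj_iff.trans (hadj i j)) hD
  · refine not_hasShortResolution_of_inducedAntihole hn (c := fun i : ZMod (m + 5) => f i)
      f.injective (fun i j => ?_) hD
    have h1 := f.map_adj_iff.trans (hadj i j)
    rw [SimpleGraph.compl_adj] at h1
    have h2 : f i = f j ↔ i = j := f.injective.eq_iff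
    by_cases hij : i = j
    · subst hij
      simp
    · tauto

/-- The projective dimension of `D(A(G))` is at most 1 if and only if `G` is
weakly chordal. -/
theorem pd_le_one_iff_weaklyChordal (ℓ : ℕ) (hℓ : 1 ≤ ℓ) (G : SimpleGraph (Fin ℓ)) :
    pd (ModuleCat.of (Spoly ℓ) (logDer ℓ G)) ≤ 1 ↔ WeaklyChordal G := by
  rw [pd_le_one_iff]
  exact ⟨fun h => weaklyChordal_of_hasShortResolution (h.of_equiv (logDerEquiv G)),
    fun h => h.hasShortResolution.of_equiv (logDerEquiv G).symm⟩
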